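/- Let G be a normal operator with compact resolvent on a complex Hilbert space H, with σ(G) ∩ Ω(2φ) ⊆ ℝ_{≥0} for some 0 < φ ≤ π/2, let S be p-subordinate to G with bound b, 0 ≤ p < 1, and T = G + S with D(T) = D(G). Let l > b, 0 ≤ l_0 < l − b and η > 0. Then there are constants C_0, C_1, r_0 > 0 such that for every r ≥ r_0 there is a set E_r ⊂ ℂ with the following properties: (i) E_r is the union of finitely many discs whose radii sum to at most η·r^p; (ii) for every z ∈ cl(Ω(φ)) \ E_r with |Re z − r| ≤ l_0·r^p one has z ∈ ρ(T), ‖(T−z)^{-1}‖ ≤ C_0·C_1^m / r^p and ‖S(T−z)^{-1}‖ ≤ C_0·C_1^m, where m = N_+(r − l·r^p, r + l·r^p, G). -/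

import Mathlib

open scoped InnerProductSpace ComplexInnerProductSpace
open Filter Metric Complex

noncomputable section

structure Op (H : Type*) [NormedAddCommGroup H] [InnerProductSpace ℂ H] : Type _ where
  dom : Submodule ℂ H
  app : H →ₗ[ℂ] H

namespace Op

variable {H : Type*} [NormedAddCommGroup H] [InnerProductSpace ℂ H]

/-- `R` is the (bounded, everywhere defined) inverse of `T - z`. -/
def IsResolventAt (T : Op H) (z : ℂ) (R : H →L[ℂ] H) : Prop :=
  (∀ x, R x ∈ T.dom) ∧ (∀ x, T.app (R x) - z • R x = x) ∧
    ∀ x ∈ T.dom, R (T.app x - z • x) = x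

def resolventSet (T : Op H) : Set ℂ := {z | ∃ R, T.IsResolventAt z R}

def spec (T : Op H) : Set ℂ := (T.resolventSet)ᶜ

def HasCompactResolvent (T : Op H) : Prop :=
  ∃ z R, T.IsResolventAt z R ∧ IsCompactOperator R

def shift (T : Op H) (lam : ℂ) : H →ₗ[ℂ] H := T.app - lam • LinearMap.id

def IsRootVector (T : Op H) (lam : ℂ) (x : H) : Prop :=
  x ≠ 0 ∧ ∃ k : ℕ, 0 < k ∧ (∀ j < k, ((T.shift lam) ^ j) x ∈ T.dom) ∧
    ((T.shift lam) ^ k) x = 0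

def rootSubspace (T : Op H) (lam : ℂ) : Submodule ℂ H :=
  Submodule.span ℂ {x | T.IsRootVector lam x}

def IsEigenvalue (T : Op H) (lam : ℂ) : Prop :=
  ∃ x, x ≠ 0 ∧ x ∈ T.dom ∧ T.app x = lam • x

def rootSystem (T : Op H) : Submodule ℂ H :=
  Submodule.span ℂ {x | ∃ lam, T.IsRootVector lam x}

def CompleteRootSystem (T : Op H) : Prop := Dense (T.rootSystem : Set H)

def IsAdjointOf (T Tstar : Op H) : Prop :=
  (Tstar.dom : Set H) = {y | ∃ w, ∀ x ∈ T.dom, ⟪T.app x, y⟫_ℂ = ⟪x, w⟫_ℂ} ∧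
    ∀ y ∈ Tstar.dom, ∀ x ∈ T.dom, ⟪T.app x, y⟫_ℂ = ⟪x, Tstar.app y⟫_ℂ

def IsClosedOp (T : Op H) : Prop :=
  IsClosed {p : H × H | p.1 ∈ T.dom ∧ p.2 = T.app p.1}

def IsNormalOp (T : Op H) : Prop :=
  Dense (T.dom : Set H) ∧ T.IsClosedOp ∧
    ∃ Tstar : Op H, T.IsAdjointOf Tstar ∧ T.dom = Tstar.dom ∧
      ∀ u ∈ T.dom, ‖T.app u‖ = ‖Tstar.app u‖

/-- `S` is `p`-subordinate to `G` with bound `b`. -/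
def Subordinate (S G : Op H) (p b : ℝ) : Prop :=
  (G.dom : Set H) ⊆ (S.dom : Set H) ∧
    ∀ u ∈ G.dom, ‖S.app u‖ ≤ b * ‖u‖ ^ (1 - p) * ‖G.app u‖ ^ p

def addOp (G S : Op H) : Op H := ⟨G.dom, G.app + S.app⟩

/-- The sum of the root subspaces for eigenvalues in `K`. -/
def specSubspace (T : Op H) (K : Set ℂ) : Submodule ℂ H :=
  ⨆ lam ∈ K, T.rootSubspace lam

/-- `N(K,T)`: total multiplicity of the eigenvalues in `K`. -/
def dimIn (T : Op H) (K : Set ℂ) : ℕ :=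
  Module.finrank ℂ (T.specSubspace K)

/-- `N_+(r₁,r₂,G)`. -/
def dimPlus (T : Op H) (r1 r2 : ℝ) : ℕ :=
  T.dimIn {z | z.im = 0 ∧ r1 < z.re ∧ z.re < r2}

end Op

def IsRieszBasisOfSubspacesWith {H : Type*} [NormedAddCommGroup H]
    [InnerProductSpace ℂ H] {Λ : Type*} (V : Λ → Submodule ℂ H) (c : ℝ) : Prop :=
  Dense (↑(⨆ k, V k) : Set H) ∧
    ∀ (F : Finset Λ) (x : Λ → H), (∀ k ∈ F, x k ∈ V k) →
      c⁻¹ * ∑ k ∈ F, ‖x k‖ ^ 2 ≤ ‖∑ k ∈ F, x k‖ ^ 2 ∧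
        ‖∑ k ∈ F, x k‖ ^ 2 ≤ c * ∑ k ∈ F, ‖x k‖ ^ 2

def IsRieszBasisOfSubspaces {H : Type*} [NormedAddCommGroup H]
    [InnerProductSpace ℂ H] {Λ : Type*} (V : Λ → Submodule ℂ H) : Prop :=
  ∃ c : ℝ, 1 ≤ c ∧ IsRieszBasisOfSubspacesWith V c

end
/-- The open sector `Ω(φ) = {r e^{iψ} : r ≥ 0, -φ < ψ < φ}`. -/
def OmegaSector (a b : ℝ) : Set ℂ :=
  {z | ∃ r φ : ℝ, 0 ≤ r ∧ a < φ ∧ φ < b ∧ z = r * Complex.exp (φ * Complex.I)}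

/-- `B` is covered by finitely many closed discs whose radii sum to at most `δ`. -/
def CoveredByDiscs (B : Set ℂ) (δ : ℝ) : Prop :=
  ∃ E : Finset (ℂ × ℝ), (∀ d ∈ E, 0 ≤ d.2) ∧ ∑ d ∈ E, d.2 ≤ δ ∧
    B ⊆ ⋃ d ∈ E, closedBall d.1 d.2

namespace CoveredByDiscs

theorem mono {A B : Set ℂ} {δ ε : ℝ} (h : CoveredByDiscs B δ) (hAB : A ⊆ B) (hδ : δ ≤ ε) :
    CoveredByDiscs A ε := by
  obtain ⟨E, h1, h2, h3⟩ := h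
  exact ⟨E, h1, h2.trans hδ, hAB.trans h3⟩

theorem empty : CoveredByDiscs ∅ 0 := ⟨∅, by simp, by simp, by simp⟩

theorem union {A B : Set ℂ} {δ ε : ℝ} (hA : CoveredByDiscs A δ) (hB : CoveredByDiscs B ε) :
    CoveredByDiscs (A ∪ B) (δ + ε) := by
  classical
  obtain ⟨E, h1, h2, h3⟩ := hA
  obtain ⟨F, k1, k2, k3⟩ := hB
  refine ⟨E ∪ F, ?_, ?_, ?_⟩
  · intro d hd
    rcases Finset.mem_union.1 hd with h | h
    exacts [h1 d h, k1 d h]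
  · have := Finset.sum_union_inter (s₁ := E) (s₂ := F) (f := fun d : ℂ × ℝ => d.2)
    have h0 : 0 ≤ ∑ d ∈ E ∩ F, d.2 :=
      Finset.sum_nonneg fun d hd => h1 d (Finset.mem_inter.1 hd).1
    linarith
  · rw [Finset.set_biUnion_union]
    exact Set.union_subset_union h3 k3

theorem biUnion {ι : Type*} (s : Finset ι) {B : ι → Set ℂ} {δ : ℝ}
    (h : ∀ i ∈ s, CoveredByDiscs (B i) δ) : CoveredByDiscs (⋃ i ∈ s, B i) (s.card * δ) := by
  classical
  induction s using Finset.induction_on with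
  | empty => simpa using empty
  | insert i s hi ih =>
    rw [Finset.set_biUnion_insert, Finset.card_insert_of_notMem hi]
    refine ((h i (by simp)).union (ih fun j hj => h j (by simp [hj]))).mono le_rfl ?_
    push_cast
    linarith

/-- The image under `w ↦ c + s w` of a set covered by discs. -/
theorem image_affine {B : Set ℂ} {δ : ℝ} (h : CoveredByDiscs B δ) (c : ℂ) {s : ℝ} (hs : 0 < s) :
    CoveredByDiscs ((fun w => c + s * w) '' B) (s * δ) := by
  classical
  obtain ⟨E, h1, h2, h3⟩ := h
  have hinj : Function.Injective (fun d : ℂ × ℝ => (c + s * d.1, s * d.2)) := by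
    rintro ⟨a, x⟩ ⟨a', x'⟩ hax
    have hs' : (s : ℂ) ≠ 0 := by exact_mod_cast hs.ne'
    simpa [hs.ne', hs'] using hax
  refine ⟨E.image fun d => (c + s * d.1, s * d.2), ?_, ?_, ?_⟩
  · intro d hd
    obtain ⟨e, he, rfl⟩ := Finset.mem_image.1 hd
    exact mul_nonneg hs.le (h1 e he)
  · rw [Finset.sum_image hinj.injOn, ← Finset.mul_sum]
    exact mul_le_mul_of_nonneg_left h2 hs.le
  · rintro _ ⟨w, hw, rfl⟩
    obtain ⟨d, hd, hwd⟩ := Set.mem_iUnion₂.1 (h3 hw)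
    refine Set.mem_iUnion₂.2 ⟨_, Finset.mem_image_of_mem _ hd, ?_⟩
    rw [mem_closedBall, dist_eq_norm] at hwd ⊢
    rw [add_sub_add_left_eq_sub, ← mul_sub, norm_mul, norm_real, Real.norm_of_nonneg hs.le]
    exact mul_le_mul_of_nonneg_left hwd hs.le

theorem radius_le {c : ℂ} {ρ δ : ℝ} (hρ : 0 ≤ ρ) (h : CoveredByDiscs (closedBall c ρ) δ) :
    ρ ≤ δ := by
  obtain ⟨E, h1, h2, h3⟩ := h
  have hvol : MeasureTheory.volume (closedBall c ρ) ≤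
      ∑ d ∈ E, MeasureTheory.volume (closedBall d.1 d.2) :=
    (MeasureTheory.measure_mono h3).trans (MeasureTheory.measure_biUnion_finset_le _ _)
  have hsq : ρ ^ 2 ≤ ∑ d ∈ E, d.2 ^ 2 := by
    simp only [Complex.volume_closedBall] at hvol
    rw [← Finset.sum_mul, ENNReal.mul_le_mul_iff_left (by simp [NNReal.pi_ne_zero]) (by simp),
      ← ENNReal.ofReal_pow hρ, Finset.sum_congr rfl
        (fun d hd => (ENNReal.ofReal_pow (h1 d hd) 2).symm),
      ← ENNReal.ofReal_sum_of_nonneg (fun d _ => sq_nonneg _)] at hvol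
    exact (ENNReal.ofReal_le_ofReal_iff (Finset.sum_nonneg fun d _ => sq_nonneg _)).1 hvol
  have hsum : ∑ d ∈ E, d.2 ^ 2 ≤ (∑ d ∈ E, d.2) ^ 2 := Finset.sum_sq_le_sq_sum_of_nonneg h1
  have h0 : 0 ≤ ∑ d ∈ E, d.2 := Finset.sum_nonneg h1
  nlinarith [abs_le_of_sq_le_sq (hsq.trans hsum) h0]

end CoveredByDiscs

theorem factorial_mul_pow_le_prod {ι : Type*} (κ : ℝ) (d : ι → ℝ) (hκ : 0 ≤ κ)
    (hd : ∀ i, 0 ≤ d i) (s : Finset ι)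
    (h : ∀ t, 0 ≤ t → ({i ∈ s | d i ≤ t}.card : ℝ) * κ ≤ t) :
    (s.card.factorial : ℝ) * κ ^ s.card ≤ ∏ i ∈ s, d i := by
  classical
  induction hn : s.card generalizing s with
  | zero => simp [Finset.card_eq_zero.1 hn]
  | succ n ih =>
    obtain ⟨i, hi, hmax⟩ := s.exists_max_image d (Finset.card_pos.1 (by omega))
    have hcard : (s.erase i).card = n := by rw [Finset.card_erase_of_mem hi]; omega
    have hi' : ((n + 1 : ℕ) : ℝ) * κ ≤ d i := by
      have := h (d i) (hd i)
      rwa [Finset.filter_true_of_mem hmax, hn] at this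
    have hrest := ih (s.erase i) (fun t ht => le_trans (by gcongr; exact s.erase_subset i) (h t ht))
      hcard
    rw [← Finset.mul_prod_erase s d hi, Nat.factorial_succ]
    calc (((n + 1) * n.factorial : ℕ) : ℝ) * κ ^ (n + 1)
        = (((n + 1 : ℕ) : ℝ) * κ) * (n.factorial * κ ^ n) := by push_cast; ring
      _ ≤ d i * ∏ j ∈ s.erase i, d j := by
          gcongr
          exact hd i

/-- A form of Cartan's lemma for products of distances. -/
theorem coveredByDiscs_prod_lt {ι : Type*} [Fintype ι] (a : ι → ℂ) {h : ℝ} (hh : 0 < h) :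
    CoveredByDiscs {w | ∏ i, ‖w - a i‖ < (h / (5 * Real.exp 1)) ^ Fintype.card ι} h := by
  classical
  rcases isEmpty_or_nonempty ι with hι | hι
  · simpa using CoveredByDiscs.empty.mono le_rfl hh.le
  set n := Fintype.card ι with hn
  have hn0 : 0 < n := Fintype.card_pos
  have hnR : (0 : ℝ) < n := by exact_mod_cast hn0
  set κ : ℝ := h / (5 * n) with hκ
  have hκ0 : 0 < κ := by positivity
  set N : ℂ → ℝ → Finset ι := fun w t => {i | ‖w - a i‖ ≤ t} with hN
  set Bad : Set ℂ := {w | ∃ t, 0 ≤ t ∧ t < (N w t).card * κ} with hBad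
  have hsub : {w | ∏ i, ‖w - a i‖ < (h / (5 * Real.exp 1)) ^ n} ⊆ Bad := by
    intro w hw
    by_contra hgood
    simp only [hBad, Set.mem_ofPred_eq, not_exists, not_and, not_lt] at hgood
    have h1 := factorial_mul_pow_le_prod κ (fun i => ‖w - a i‖) hκ0.le (fun _ => norm_nonneg _)
      Finset.univ hgood
    have h2 : ((n : ℝ) ^ n) / n.factorial ≤ Real.exp n :=
      Real.pow_div_factorial_le_exp n hnR.le n
    have h3 : (h / (5 * Real.exp 1)) ^ n ≤ n.factorial * κ ^ n := by
      rw [div_le_iff₀ (by positivity)] at h2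
      have e : Real.exp n = Real.exp 1 ^ n := by rw [← Real.exp_nat_mul, mul_one]
      rw [e] at h2
      rw [hκ, div_pow, div_pow, mul_pow, mul_pow, mul_div_assoc', div_le_div_iff₀ (by positivity)
        (by positivity)]
      have : 0 < h ^ n * 5 ^ n := by positivity
      nlinarith
    exact absurd (lt_of_lt_of_le hw h3) (not_lt.2 h1)
  refine CoveredByDiscs.mono ?_ hsub le_rfl
  choose! t ht0 ht using fun w (hw : w ∈ Bad) => hw
  obtain ⟨u, huB, hdisj, hcov⟩ := Vitali.exists_disjoint_subfamily_covering_enlargement_closedBall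
    Bad id t (n * κ) (fun w hw => (ht w hw).le.trans
      (by gcongr; exact Finset.card_le_univ _)) 5 (by norm_num)
  have hne : ∀ w ∈ u, ∃ i, i ∈ N w (t w) := by
    intro w hw
    by_contra hemp
    have h0 := ht w (huB hw)
    rw [Finset.card_eq_zero.2 (Finset.eq_empty_of_forall_notMem (not_exists.1 hemp))] at h0
    have := ht0 w (huB hw)
    simp at h0
    linarith
  have hdisjN : ∀ w ∈ u, ∀ v ∈ u, w ≠ v → Disjoint (N w (t w)) (N v (t v)) := by
    intro w hw v hv hwv
    rw [Finset.disjoint_left]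
    intro i hi hi'
    have hmem : ∀ v, i ∈ N v (t v) → a i ∈ closedBall (id v) (t v) := fun v hv => by
      simpa [hN, mem_closedBall, dist_eq_norm, norm_sub_rev] using hv
    exact Set.disjoint_left.1 (hdisj hw hv hwv) (hmem w hi) (hmem v hi')
  have hfin : u.Finite := by
    choose! j hj using hne
    refine Set.Finite.of_injOn (t := Set.univ) (f := j) (fun _ _ => Set.mem_univ _) ?_
      Set.finite_univ
    intro w hw v hv hwv
    by_contra hne'
    exact Finset.disjoint_left.1 (hdisjN w hw v hv hne') (hj w hw) (hwv ▸ hj v hv)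
  have hinj : Function.Injective fun w : ℂ => (w, 5 * t w) := fun w v hwv =>
    congrArg Prod.fst hwv
  refine ⟨hfin.toFinset.image fun w => (w, 5 * t w), ?_, ?_, ?_⟩
  · intro d hd
    obtain ⟨w, hw, rfl⟩ := Finset.mem_image.1 hd
    have := ht0 w (huB (hfin.mem_toFinset.1 hw))
    simpa using this
  · rw [Finset.sum_image hinj.injOn]
    have hle : ∑ w ∈ hfin.toFinset, t w ≤ n * κ := by
      calc ∑ w ∈ hfin.toFinset, t w ≤ ∑ w ∈ hfin.toFinset, ((N w (t w)).card : ℝ) * κ :=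
            Finset.sum_le_sum fun w hw => (ht w (huB (hfin.mem_toFinset.1 hw))).le
        _ = ((hfin.toFinset.biUnion fun w => N w (t w)).card : ℝ) * κ := by
            rw [← Finset.sum_mul, Finset.card_biUnion]
            · push_cast; rfl
            · intro w hw v hv hwv
              exact hdisjN w (hfin.mem_toFinset.1 hw) v (hfin.mem_toFinset.1 hv) hwv
        _ ≤ n * κ := by gcongr; exact Finset.card_le_univ _
    rw [← Finset.mul_sum]
    calc 5 * ∑ w ∈ hfin.toFinset, t w ≤ 5 * (n * κ) := by gcongr
      _ = h := by rw [hκ]; field_simp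
  · intro w hw
    obtain ⟨v, hv, hwv⟩ := hcov w hw
    refine Set.mem_iUnion₂.2 ⟨(v, 5 * t v), Finset.mem_image_of_mem _ (hfin.mem_toFinset.2 hv), ?_⟩
    exact hwv (mem_closedBall_self (ht0 w hw))

/-- Dividing out the zeros of a holomorphic function in a disc, with uniform bounds. -/
theorem exists_eq_prod_mul_of_norm_le {U : Set ℂ} (hU : IsOpen U) {w₀ : ℂ} {R M : ℝ} (hR : 0 < R)
    (hUR : closedBall w₀ (3 * R) ⊆ U) (N : ℕ) (f : ℂ → ℂ) (hf : DifferentiableOn ℂ f U)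
    (hM : ∀ z ∈ closedBall w₀ (3 * R), ‖f z‖ ≤ M) (hN : M < ‖f w₀‖ * 2 ^ N) :
    ∃ (n : ℕ) (a : Fin n → ℂ) (g : ℂ → ℂ), DifferentiableOn ℂ g U ∧
      (∀ z ∈ closedBall w₀ (3 * R), ‖g z‖ ≤ M) ∧ (∀ z ∈ closedBall w₀ R, g z ≠ 0) ∧
      ‖f w₀‖ * 2 ^ n ≤ ‖g w₀‖ ∧ ∀ z, f z = (∏ j, (z - a j) / (2 * R)) * g z := by
  have hw₀ : w₀ ∈ closedBall w₀ (3 * R) := mem_closedBall_self (by positivity)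
  induction N generalizing f with
  | zero =>
    have := hM w₀ hw₀
    simp at hN
    linarith
  | succ N ih =>
    by_cases hz : ∀ z ∈ closedBall w₀ R, f z ≠ 0
    · exact ⟨0, Fin.elim0, f, hf, hM, hz, by simp, by simp⟩
    push Not at hz
    obtain ⟨a, ha, hfa⟩ := hz
    have hRC : (R : ℂ) ≠ 0 := by exact_mod_cast hR.ne'
    have hnR : ‖(2 * R : ℂ)‖ = 2 * R := by
      rw [norm_mul, norm_real, Real.norm_of_nonneg hR.le]; norm_num
    have haU : U ∈ nhds a := hU.mem_nhds (hUR (closedBall_subset_closedBall (by linarith) ha))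
    set f₁ : ℂ → ℂ := fun z => 2 * R * dslope f a z with hf₁
    have hmul : ∀ z, f z = (z - a) / (2 * R) * f₁ z := by
      intro z
      have := sub_smul_dslope f a z
      rw [hfa, sub_zero, smul_eq_mul] at this
      rw [hf₁, ← this]
      field_simp
    have hd : DifferentiableOn ℂ f₁ U :=
      ((differentiableOn_dslope haU).2 hf).const_mul _
    have hnorm : ∀ z, ‖f z‖ * (2 * R) = ‖z - a‖ * ‖f₁ z‖ := by
      intro z
      rw [hmul z, norm_mul, norm_div, hnR]
      field_simp
    rw [mem_closedBall, dist_eq_norm] at ha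
    have hM₁ : ∀ z ∈ closedBall w₀ (3 * R), ‖f₁ z‖ ≤ M := by
      intro z hz
      refine Complex.norm_le_of_forall_mem_frontier_norm_le (U := ball w₀ (3 * R)) isBounded_ball
        ?_ ?_ (by rwa [closure_ball _ (by positivity)])
      · refine (hd.mono ?_).diffContOnCl
        rwa [closure_ball _ (by positivity)]
      · intro y hy
        rw [frontier_ball _ (by positivity)] at hy
        have hy' : ‖y - w₀‖ = 3 * R := by simpa [dist_eq_norm] using hy
        have h2 : 2 * R ≤ ‖y - a‖ := by
          have := norm_sub_le_norm_sub_add_norm_sub y a w₀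
          linarith
        have h3 := hnorm y
        have h4 := hM y (sphere_subset_closedBall hy)
        by_contra! hlt
        have : 2 * R * ‖f₁ y‖ ≤ ‖y - a‖ * ‖f₁ y‖ := by gcongr
        nlinarith
    have hgrow : ‖f w₀‖ * 2 ≤ ‖f₁ w₀‖ := by
      have h3 := hnorm w₀
      have : ‖w₀ - a‖ * ‖f₁ w₀‖ ≤ R * ‖f₁ w₀‖ := by
        gcongr
        rwa [norm_sub_rev]
      nlinarith
    obtain ⟨n, b, g, hg1, hg2, hg3, hg4, hg5⟩ := ih f₁ hd hM₁ (by
      calc M < ‖f w₀‖ * 2 ^ (N + 1) := hN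
        _ = (‖f w₀‖ * 2) * 2 ^ N := by ring
        _ ≤ ‖f₁ w₀‖ * 2 ^ N := by gcongr)
    refine ⟨n + 1, Fin.cons a b, g, hg1, hg2, hg3, ?_, ?_⟩
    · calc ‖f w₀‖ * 2 ^ (n + 1) = (‖f w₀‖ * 2) * 2 ^ n := by ring
        _ ≤ ‖f₁ w₀‖ * 2 ^ n := by gcongr
        _ ≤ _ := hg4
    · intro z
      rw [Fin.prod_univ_succ, hmul z, hg5 z]
      simp [mul_assoc]

/-- A lower bound of Harnack type for holomorphic functions without zeros in a disc. -/
theorem exp_neg_le_norm_of_ne_zero {g : ℂ → ℂ} {w₀ : ℂ} {R A : ℝ} (hR : 0 < R) (hA : 0 < A)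
    (hg : DifferentiableOn ℂ g (ball w₀ R)) (hg0 : ∀ z ∈ ball w₀ R, g z ≠ 0)
    (hgA : ∀ z ∈ ball w₀ R, ‖g z‖ ≤ Real.exp A) (hw₀ : Real.exp (-A) ≤ ‖g w₀‖) :
    ∀ z ∈ closedBall w₀ (R / 2), Real.exp (-(5 * A)) ≤ ‖g z‖ := by
  have hmem : w₀ ∈ ball w₀ R := mem_ball_self hR
  obtain ⟨h, hh0, hh⟩ := ((hg.deriv isOpen_ball).div hg hg0).isExactOn_ball.with_val_at w₀ 0
  have hexp : ∀ z ∈ ball w₀ R, g z = g w₀ * Complex.exp (h z) := by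
    intro z hz
    have hderiv : ∀ y ∈ ball w₀ R, HasDerivAt (fun y => g y * Complex.exp (-h y)) 0 y := by
      intro y hy
      have h1 := (hg.differentiableAt (isOpen_ball.mem_nhds hy)).hasDerivAt
      have h2 := h1.mul (hh y hy).neg.cexp
      have h3 : deriv g y * Complex.exp (-h y) +
          g y * (Complex.exp (-h y) * -(deriv g y / g y)) = 0 := by
        have := hg0 y hy
        field_simp
        ring
      rw [← h3]
      exact h2
    have hconst := (convex_ball w₀ R).is_const_of_fderivWithin_eq_zero (𝕜 := ℂ)
      (f := fun y => g y * Complex.exp (-h y))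
      (fun y hy => (hderiv y hy).differentiableAt.differentiableWithinAt)
      (fun y hy => by
        rw [fderivWithin_of_isOpen isOpen_ball hy]
        ext
        simpa using (hderiv y hy).deriv) hz hmem
    simp only [hh0, neg_zero, Complex.exp_zero, mul_one] at hconst
    rw [← hconst, mul_assoc, ← Complex.exp_add]
    simp
  have hre : ∀ z ∈ ball w₀ R, (h z).re ≤ 2 * A := by
    intro z hz
    have h1 := hgA z hz
    rw [hexp z hz, norm_mul, Complex.norm_exp] at h1
    have h2 : Real.exp (-A) * Real.exp (h z).re ≤ Real.exp A :=
      le_trans (by gcongr) h1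
    rw [← Real.exp_add, Real.exp_le_exp] at h2
    linarith
  intro z hz
  have hz' : ‖z - w₀‖ ≤ R / 2 := by simpa [dist_eq_norm] using hz
  have hadd : ∀ y ∈ ball (0 : ℂ) R, w₀ + y ∈ ball w₀ R := by
    intro y hy
    simpa [dist_eq_norm] using hy
  have hzR : z ∈ ball w₀ R := by
    rw [mem_ball, dist_eq_norm]; linarith
  have hBC := Complex.borelCaratheodory_zero (f := fun y => h (w₀ + y)) (M := 2 * A) (R := R)
    (z := z - w₀) (by positivity)
    (fun y hy => ((hh _ (hadd y hy)).differentiableAt.comp y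
      (by fun_prop)).differentiableWithinAt)
    (fun y hy => hre _ (hadd y hy)) hR (by simpa using (by linarith : ‖z - w₀‖ < R))
    (by simpa using hh0)
  simp only [add_sub_cancel] at hBC
  have hle : ‖h z‖ ≤ 4 * A := by
    refine hBC.trans ?_
    rw [div_le_iff₀ (by linarith)]
    nlinarith
  rw [hexp z hzR, norm_mul, Complex.norm_exp]
  have h1 : -(4 * A) ≤ (h z).re := by
    have := (abs_le.1 (Complex.abs_re_le_norm (h z))).1
    linarith
  calc Real.exp (-(5 * A)) = Real.exp (-A) * Real.exp (-(4 * A)) := by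
        rw [← Real.exp_add]; ring_nf
    _ ≤ ‖g w₀‖ * Real.exp (h z).re := by gcongr

/-- A Cartan type lower bound for holomorphic functions near a point where they are not small. -/
theorem exists_coveredByDiscs_norm_lt_closedBall {R δ : ℝ} (hR : 0 < R) (hδ : 0 < δ) :
    ∃ C : ℝ, 1 ≤ C ∧ ∀ (U : Set ℂ) (w₀ : ℂ) (A : ℝ) (f : ℂ → ℂ), IsOpen U →
      closedBall w₀ (3 * R) ⊆ U → 0 < A → DifferentiableOn ℂ f U →
      (∀ z ∈ closedBall w₀ (3 * R), ‖f z‖ ≤ Real.exp A) → Real.exp (-A) ≤ ‖f w₀‖ →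
      CoveredByDiscs {z ∈ closedBall w₀ (R / 2) | ‖f z‖ < Real.exp (-(C * A))} δ := by
  set θ : ℝ := δ / (5 * Real.exp 1) / (2 * R) with hθ
  have hθ0 : 0 < θ := by positivity
  refine ⟨5 + 3 * |Real.log θ|, by linarith [abs_nonneg (Real.log θ)], ?_⟩
  intro U w₀ A f hU hUR hA hf hfA hfw
  have hf0 : 0 < ‖f w₀‖ := (Real.exp_pos _).trans_le hfw
  obtain ⟨N, hN⟩ := pow_unbounded_of_one_lt (Real.exp A / ‖f w₀‖) (by norm_num : (1 : ℝ) < 2)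
  rw [div_lt_iff₀ hf0, mul_comm] at hN
  obtain ⟨n, a, g, hg, hgA, hg0, hgrow, hfac⟩ :=
    exists_eq_prod_mul_of_norm_le hU hR hUR N f hf hfA hN
  have hw₀ : w₀ ∈ closedBall w₀ (3 * R) := mem_closedBall_self (by positivity)
  have hn : (n : ℝ) ≤ 3 * A := by
    have h1 : Real.exp (-A) * 2 ^ n ≤ Real.exp A :=
      le_trans (by gcongr) (hgrow.trans (hgA w₀ hw₀))
    have h2 : Real.exp (n * Real.log 2 - A) ≤ Real.exp A := by
      rw [sub_eq_neg_add, Real.exp_add, Real.exp_nat_mul, Real.exp_log (by norm_num)]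
      exact h1
    rw [Real.exp_le_exp] at h2
    have := Real.log_two_gt_d9
    have hn0 : (0 : ℝ) ≤ n := n.cast_nonneg
    nlinarith
  have hsub : ball w₀ R ⊆ closedBall w₀ (3 * R) :=
    ball_subset_closedBall.trans (closedBall_subset_closedBall (by linarith))
  have hlow := exp_neg_le_norm_of_ne_zero hR hA (hg.mono (hsub.trans hUR))
    (fun z hz => hg0 z (ball_subset_closedBall hz)) (fun z hz => hgA z (hsub hz))
    (hfw.trans ((le_mul_of_one_le_right (norm_nonneg _) (one_le_pow₀ (by norm_num))).trans hgrow))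
  refine (coveredByDiscs_prod_lt a hδ).mono ?_ le_rfl
  rintro z ⟨hz, hlt⟩
  by_contra hge
  simp only [Set.mem_ofPred_eq, not_lt, Fintype.card_fin] at hge
  have hprod : θ ^ n ≤ ‖∏ j, (z - a j) / (2 * R)‖ := by
    have hnR : ‖(2 * R : ℂ)‖ = 2 * R := by
      rw [norm_mul, norm_real, Real.norm_of_nonneg hR.le]; norm_num
    rw [norm_prod]
    simp only [norm_div, hnR, Finset.prod_div_distrib, Finset.prod_const, Finset.card_univ,
      Fintype.card_fin]
    rw [hθ, div_pow _ (2 * R)]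
    gcongr
  have hθn : Real.exp (-(3 * A * |Real.log θ|)) ≤ θ ^ n := by
    conv_rhs => rw [← Real.exp_log hθ0, ← Real.exp_nat_mul]
    rw [Real.exp_le_exp]
    have h1 : (n : ℝ) * |Real.log θ| ≤ 3 * A * |Real.log θ| := by gcongr
    have h2 : (n : ℝ) * -|Real.log θ| ≤ n * Real.log θ := by
      gcongr
      exact neg_abs_le _
    linarith
  refine absurd hlt (not_lt.2 ?_)
  rw [hfac z, norm_mul]
  calc Real.exp (-((5 + 3 * |Real.log θ|) * A))
      = Real.exp (-(3 * A * |Real.log θ|)) * Real.exp (-(5 * A)) := by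
        rw [← Real.exp_add]; ring_nf
    _ ≤ _ := mul_le_mul (hθn.trans hprod) (hlow z hz) (Real.exp_pos _).le (norm_nonneg _)

/-- A Cartan type lower bound for holomorphic functions on a convex compact set. -/
theorem exists_coveredByDiscs_norm_lt {K U : Set ℂ} (hK : IsCompact K) (hKc : Convex ℝ K)
    (hU : IsOpen U) {R : ℝ} (hR : 0 < R) (hKU : ∀ c ∈ K, closedBall c (4 * R) ⊆ U)
    {w₁ : ℂ} (hw₁ : w₁ ∈ K) {δ : ℝ} (hδ : 0 < δ) :
    ∃ C : ℝ, 1 ≤ C ∧ ∀ (A : ℝ) (f : ℂ → ℂ), 0 < A → DifferentiableOn ℂ f U →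
      (∀ z ∈ U, ‖f z‖ ≤ Real.exp A) → Real.exp (-A) ≤ ‖f w₁‖ →
      CoveredByDiscs {z ∈ K | ‖f z‖ < Real.exp (-(C * A))} δ := by
  set ρ : ℝ := R / 6 with hρ
  have hρ0 : 0 < ρ := by positivity
  let P : ℂ → Prop := fun c => ∃ C : ℝ, 1 ≤ C ∧ ∀ (A : ℝ) (f : ℂ → ℂ), 0 < A →
    DifferentiableOn ℂ f U → (∀ z ∈ U, ‖f z‖ ≤ Real.exp A) → Real.exp (-A) ≤ ‖f w₁‖ →
    ∃ w ∈ closedBall c ρ, Real.exp (-(C * A)) ≤ ‖f w‖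
  have hball : ∀ c ∈ K, ∀ w ∈ closedBall c ρ, closedBall w (3 * R) ⊆ U := by
    intro c hc w hw
    refine (closedBall_subset_closedBall' ?_).trans (hKU c hc)
    rw [mem_closedBall] at hw
    linarith
  have hstep : ∀ c ∈ K, ∀ c' : ℂ, dist c' c ≤ ρ → P c → P c' := by
    rintro c hc c' hcc' ⟨C, hC1, hC⟩
    obtain ⟨C', hC'1, hC'⟩ := exists_coveredByDiscs_norm_lt_closedBall hR (half_pos hρ0)
    refine ⟨C' * C, by nlinarith, fun A f hA hf hfA hfw => ?_⟩
    obtain ⟨w, hw, hfw'⟩ := hC A f hA hf hfA hfw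
    have hUw := hball c hc w hw
    have hcov := hC' U w (C * A) f hU hUw (by positivity) hf
      (fun z hz => (hfA z (hUw hz)).trans (Real.exp_le_exp.2 (by nlinarith))) hfw'
    by_contra! hall
    have := (hcov.mono (A := closedBall c' ρ) (fun z hz => ⟨?_, ?_⟩) le_rfl).radius_le hρ0.le
    · linarith
    · rw [mem_closedBall] at hz hw ⊢
      have h1 := dist_triangle4 z c' c w
      rw [dist_comm c w] at h1
      linarith
    · simpa only [mul_assoc] using hall z hz
  have hP : ∀ c ∈ K, P c := by
    intro c hc
    obtain ⟨N, hN⟩ := exists_nat_gt (dist c w₁ / ρ)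
    have hN0 : (0 : ℝ) < N := (div_nonneg dist_nonneg hρ0.le).trans_lt hN
    rw [div_lt_iff₀ hρ0] at hN
    have hline : ∀ k : ℕ, k ≤ N → P (AffineMap.lineMap w₁ c ((k : ℝ) / N)) := by
      intro k
      induction k with
      | zero =>
        intro _
        refine ⟨1, le_rfl, fun A f hA hf hfA hfw => ⟨w₁, ?_, by simpa using hfw⟩⟩
        simpa using hρ0.le
      | succ k ih =>
        intro hk
        refine hstep _ (hKc.lineMap_mem hw₁ hc ⟨by positivity, ?_⟩) _ ?_ (ih (by omega))
        · rw [div_le_one hN0]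
          exact_mod_cast (by omega : k ≤ N)
        · rw [dist_lineMap_lineMap, Real.dist_eq, ← sub_div]
          push_cast
          rw [add_sub_cancel_left, abs_of_pos (by positivity), dist_comm]
          rw [div_mul_eq_mul_div, one_mul, div_le_iff₀ hN0]
          linarith
    have := hline N le_rfl
    rwa [div_self hN0.ne', AffineMap.lineMap_apply_one] at this
  obtain ⟨t, htK, htfin, hcover⟩ := hK.finite_cover_balls hρ0
  set T := htfin.toFinset with hT
  choose! C hC1 hC using hP
  have hδ' : 0 < δ / (T.card + 1) := by positivity
  obtain ⟨C', hC'1, hC'⟩ := exists_coveredByDiscs_norm_lt_closedBall hR hδ'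
  have hsum : ∀ c ∈ t, C c ≤ ∑ c ∈ T, C c := fun c hc =>
    Finset.single_le_sum (f := C)
      (fun x hx => zero_le_one.trans (hC1 x (htK (htfin.mem_toFinset.1 hx))))
      (htfin.mem_toFinset.2 hc)
  have hsum0 : 0 ≤ ∑ c ∈ T, C c := Finset.sum_nonneg
    fun x hx => zero_le_one.trans (hC1 x (htK (htfin.mem_toFinset.1 hx)))
  refine ⟨C' * (1 + ∑ c ∈ T, C c), by nlinarith, fun A f hA hf hfA hfw => ?_⟩
  have hloc : ∀ c ∈ T, CoveredByDiscs {z ∈ closedBall c ρ |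
      ‖f z‖ < Real.exp (-(C' * (1 + ∑ c ∈ T, C c) * A))} (δ / (T.card + 1)) := by
    intro c hc
    have hct := htfin.mem_toFinset.1 hc
    obtain ⟨w, hw, hfw'⟩ := hC c (htK hct) A f hA hf hfA hfw
    have hUw := hball c (htK hct) w hw
    have hC1c := hC1 c (htK hct)
    refine (hC' U w (C c * A) f hU hUw (by positivity) hf
      (fun z hz => (hfA z (hUw hz)).trans (Real.exp_le_exp.2 (by nlinarith))) hfw').mono ?_ le_rfl
    rintro z ⟨hz, hlt⟩
    refine ⟨?_, hlt.trans_le (Real.exp_le_exp.2 (neg_le_neg ?_))⟩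
    · rw [mem_closedBall] at hz hw ⊢
      have h1 := dist_triangle z c w
      rw [dist_comm c w] at h1
      linarith
    · rw [mul_assoc]
      gcongr
      linarith [hsum c hct]
  refine (CoveredByDiscs.biUnion T hloc).mono ?_ ?_
  · rintro z ⟨hz, hlt⟩
    obtain ⟨c, hc, hzc⟩ := Set.mem_iUnion₂.1 (hcover hz)
    exact Set.mem_iUnion₂.2 ⟨c, htfin.mem_toFinset.2 hc, ball_subset_closedBall hzc, hlt⟩
  · rw [mul_div_assoc', div_le_iff₀ (by positivity)]
    nlinarith

theorem IsStarNormal.sub_algebraMap {H : Type*} [NormedAddCommGroup H]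
    [InnerProductSpace ℂ H] [CompleteSpace H] {T : H →L[ℂ] H} (hT : IsStarNormal T) (μ : ℂ) :
    IsStarNormal (T - algebraMap ℂ (H →L[ℂ] H) μ) := by
  refine ⟨?_⟩
  rw [star_sub, ← algebraMap_star_comm]
  have h1 : Commute (star T) T := hT.star_comm_self
  have h2 : ∀ (ν : ℂ) (S : H →L[ℂ] H), Commute (algebraMap ℂ (H →L[ℂ] H) ν) S :=
    fun ν S => Algebra.commutes ν S
  exact (h1.sub_right (h2 _ _).symm).sub_left ((h2 _ _).sub_right (h2 _ _))

theorem IsStarNormal.adjoint_apply_eq_of_apply_eq {H : Type*} [NormedAddCommGroup H]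
    [InnerProductSpace ℂ H] [CompleteSpace H] {T : H →L[ℂ] H} (hT : IsStarNormal T) {μ : ℂ} {x : H}
    (hx : T x = μ • x) : ContinuousLinearMap.adjoint T x = (starRingEnd ℂ μ) • x := by
  have h1 := (ContinuousLinearMap.IsStarNormal.adjoint_apply_eq_zero_iff
    (hT.sub_algebraMap μ) x).2 (by simp [ContinuousLinearMap.algebraMap_apply, hx])
  rw [map_sub, Algebra.algebraMap_eq_smul_one, map_smulₛₗ, ContinuousLinearMap.one_def,
    ContinuousLinearMap.adjoint_id] at h1
  simpa [sub_eq_zero] using h1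

theorem IsStarNormal.apply_eq_zero_of_pow_apply_eq_zero {H : Type*} [NormedAddCommGroup H]
    [InnerProductSpace ℂ H] [CompleteSpace H] {T : H →L[ℂ] H} (hT : IsStarNormal T) (k : ℕ)
    {x : H} (hx : (T ^ (k + 1)) x = 0) : T x = 0 := by
  induction k with
  | zero => simpa using hx
  | succ k ih =>
    refine ih ?_
    rw [pow_succ', mul_apply_eq_comp] at hx
    have h1 := (ContinuousLinearMap.IsStarNormal.adjoint_apply_eq_zero_iff hT _).2 hx
    rw [← inner_self_eq_zero (𝕜 := ℂ)]
    nth_rewrite 1 [pow_succ']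
    rw [mul_apply_eq_comp, ← ContinuousLinearMap.adjoint_inner_right, h1, inner_zero_right]

/-- The eigenspaces of an injective compact normal operator are total. -/
theorem IsStarNormal.orthogonal_iSup_eigenspace_eq_bot {H : Type*} [NormedAddCommGroup H]
    [InnerProductSpace ℂ H] [CompleteSpace H] {T : H →L[ℂ] H} (hT : IsStarNormal T)
    (hc : IsCompactOperator T) (hinj : ∀ x, T x = 0 → x = 0) :
    (⨆ μ, Module.End.eigenspace (T : Module.End ℂ H) μ)ᗮ = ⊥ := by
  set B : H →L[ℂ] H := ContinuousLinearMap.adjoint T * T with hB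
  have hBc : IsCompactOperator B := hc.clm_comp (ContinuousLinearMap.adjoint T)
  have hBs : B.IsSymmetric := (IsSelfAdjoint.star_mul_self T).isSymmetric
  have hcomm : Commute B T := by
    have h1 : Commute (star T) T := hT.star_comm_self
    exact h1.mul_left (Commute.refl T)
  rw [eq_bot_iff, ← ContinuousLinearMap.orthogonalComplement_iSup_eigenspaces_eq_bot hBc hBs]
  refine Submodule.orthogonal_le (iSup_le fun s => ?_)
  set E := Module.End.eigenspace (B : Module.End ℂ H) s with hE
  have hEmem : ∀ x, x ∈ E ↔ B x = s • x := fun x => by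
    rw [hE, Module.End.mem_eigenspace_iff]; rfl
  by_cases hs : s = 0
  · intro x hx
    rw [hEmem, hs, zero_smul] at hx
    have h0 : T x = 0 := by
      rw [← inner_self_eq_zero (𝕜 := ℂ), ← ContinuousLinearMap.adjoint_inner_left]
      change ⟪B x, x⟫_ℂ = 0
      rw [hx, inner_zero_left]
    rw [hinj x h0]
    exact zero_mem _
  · have hfd : FiniteDimensional ℂ E :=
      ContinuousLinearMap.finite_dimensional_eigenspace hBc s hs
    have hinv : ∀ x ∈ E, (T : Module.End ℂ H) x ∈ E := by
      intro x hx
      rw [hEmem] at hx ⊢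
      have h1 : B (T x) = T (B x) := DFunLike.congr_fun hcomm.eq x
      rw [ContinuousLinearMap.coe_coe, h1, hx, map_smul]
    set f : Module.End ℂ E := (T : Module.End ℂ H).restrict hinv with hf
    have htop : (⨆ μ, Module.End.maxGenEigenspace f μ) = ⊤ :=
      Module.End.iSup_maxGenEigenspace_eq_top f
    have hmap : Submodule.map E.subtype (⨆ μ, Module.End.maxGenEigenspace f μ) ≤
        ⨆ μ, Module.End.eigenspace (T : Module.End ℂ H) μ := by
      rw [Submodule.map_iSup]
      refine iSup_mono fun μ => ?_
      rintro _ ⟨y, hy, rfl⟩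
      obtain ⟨k, hk⟩ := (Module.End.mem_maxGenEigenspace f μ y).1 hy
      have hpow : ∀ j : ℕ, (((f - μ • (1 : Module.End ℂ E)) ^ j) y : H) =
          ((T - algebraMap ℂ (H →L[ℂ] H) μ) ^ j) (y : H) := by
        intro j
        induction j with
        | zero => simp
        | succ j ih =>
          rw [pow_succ', pow_succ', Module.End.mul_apply, mul_apply_eq_comp, ← ih]
          simp [hf, ContinuousLinearMap.algebraMap_apply]
      have h0 : ((T - algebraMap ℂ (H →L[ℂ] H) μ) ^ (k + 1)) (y : H) = 0 := by
        rw [pow_succ', mul_apply_eq_comp, ← hpow, hk]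
        simp
      have h1 := (hT.sub_algebraMap μ).apply_eq_zero_of_pow_apply_eq_zero k h0
      rw [Module.End.mem_eigenspace_iff]
      simpa [ContinuousLinearMap.algebraMap_apply, sub_eq_zero] using h1
    rw [htop, Submodule.map_top, Submodule.range_subtype] at hmap
    exact hmap

/-- An injective compact normal operator has an orthonormal basis of eigenvectors. -/
theorem IsStarNormal.exists_hilbertBasis {H : Type*} [NormedAddCommGroup H]
    [InnerProductSpace ℂ H] [CompleteSpace H] {T : H →L[ℂ] H} (hT : IsStarNormal T)
    (hc : IsCompactOperator T) (hinj : ∀ x, T x = 0 → x = 0) :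
    ∃ (ι : Type) (e : HilbertBasis ι ℂ H) (ν : ι → ℂ), ∀ i, ν i ≠ 0 ∧ T (e i) = ν i • e i := by
  have hbot : Module.End.eigenspace (T : Module.End ℂ H) 0 = ⊥ := by
    rw [eq_bot_iff]
    intro x hx
    rw [Module.End.mem_eigenspace_iff, zero_smul] at hx
    exact hinj x hx
  have hfd : ∀ μ, FiniteDimensional ℂ (Module.End.eigenspace (T : Module.End ℂ H) μ) := by
    intro μ
    by_cases hμ : μ = 0
    · rw [hμ, hbot]
      infer_instance
    · exact ContinuousLinearMap.finite_dimensional_eigenspace hc μ hμ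
  have horth : OrthogonalFamily ℂ (fun μ => Module.End.eigenspace (T : Module.End ℂ H) μ)
      fun μ => (Module.End.eigenspace (T : Module.End ℂ H) μ).subtypeₗᵢ := by
    rintro μ ν hμν ⟨v, hv⟩ ⟨w, hw⟩
    rw [Module.End.mem_eigenspace_iff, ContinuousLinearMap.coe_coe] at hv hw
    have hw' := hT.adjoint_apply_eq_of_apply_eq hw
    have h1 : ⟪T v, w⟫_ℂ = ⟪v, ContinuousLinearMap.adjoint T w⟫_ℂ :=
      (ContinuousLinearMap.adjoint_inner_right T v w).symm
    rw [hv, hw', inner_smul_left, inner_smul_right] at h1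
    have h2 : (starRingEnd ℂ μ - starRingEnd ℂ ν) * ⟪v, w⟫_ℂ = 0 := by rw [sub_mul, h1, sub_self]
    rcases mul_eq_zero.1 h2 with h | h
    · exact absurd ((starRingEnd ℂ).injective (sub_eq_zero.1 h)) hμν
    · exact h
  have hon := horth.orthonormal_sigma_orthonormal
    (fun μ => (stdOrthonormalBasis ℂ (Module.End.eigenspace (T : Module.End ℂ H) μ)).orthonormal)
  refine ⟨_, HilbertBasis.mkOfOrthogonalEqBot hon ?_, fun i => i.1, fun i => ?_⟩
  · rw [eq_bot_iff, ← hT.orthogonal_iSup_eigenspace_eq_bot hc hinj]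
    refine Submodule.orthogonal_le (iSup_le fun μ x hx => ?_)
    have h1 := (stdOrthonormalBasis ℂ
      (Module.End.eigenspace (T : Module.End ℂ H) μ)).sum_repr ⟨x, hx⟩
    have h2 := congrArg (Submodule.subtype _) h1
    rw [map_sum] at h2
    change _ = x at h2
    rw [← h2]
    refine Submodule.sum_mem _ fun j _ => ?_
    rw [map_smul]
    exact Submodule.smul_mem _ _ (Submodule.subset_span ⟨⟨μ, j⟩, rfl⟩)
  · rw [HilbertBasis.coe_mkOfOrthogonalEqBot]
    obtain ⟨μ, j⟩ := i
    have hmem := Module.End.mem_eigenspace_iff.1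
      (stdOrthonormalBasis ℂ (Module.End.eigenspace (T : Module.End ℂ H) μ) j).2
    refine ⟨fun h0 => ?_, hmem⟩
    change μ = 0 at h0
    have h1 : T (stdOrthonormalBasis ℂ (Module.End.eigenspace (T : Module.End ℂ H) μ) j) = 0 :=
      hmem.trans (smul_eq_zero_of_left h0 _)
    exact (stdOrthonormalBasis ℂ
      (Module.End.eigenspace (T : Module.End ℂ H) μ)).orthonormal.ne_zero j
      (Subtype.ext (hinj _ h1))

theorem IsCompactOperator.finite_setOf_le_norm {H ι : Type*} [NormedAddCommGroup H]
    [InnerProductSpace ℂ H] {T : H →L[ℂ] H} (hc : IsCompactOperator T) {e : ι → H}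
    (he : Orthonormal ℂ e) {ν : ι → ℂ} (hν : ∀ i, T (e i) = ν i • e i) {c : ℝ} (hc0 : 0 < c) :
    {i | c ≤ ‖ν i‖}.Finite := by
  by_contra hinf
  let f := Set.Infinite.natEmbedding _ hinf
  have hcomp := hc.isCompact_closure_image_closedBall 1
  obtain ⟨x, -, φ, hφ, hlim⟩ := hcomp.tendsto_subseq (x := fun n => T (e (f n)))
    (fun n => subset_closure ⟨_, by simp [he.1], rfl⟩)
  obtain ⟨N, hN⟩ := Metric.cauchySeq_iff'.1 hlim.cauchySeq c hc0
  have hlt := hN (N + 1) (by omega)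
  have hne : (f (φ (N + 1)) : ι) ≠ f (φ N) := by
    intro h
    have := hφ.injective (f.injective (Subtype.ext h))
    omega
  have hi : c ≤ ‖ν (f (φ (N + 1)))‖ := (f (φ (N + 1))).2
  have h0 : ⟪e (f (φ (N + 1))), T (e (f (φ (N + 1)))) - T (e (f (φ N)))⟫_ℂ =
      ν (f (φ (N + 1))) := by
    rw [hν, hν, inner_sub_right, inner_smul_right, inner_smul_right, he.2 hne,
      inner_self_eq_norm_sq_to_K, he.1]
    simp
  have h1 := norm_inner_le_norm (𝕜 := ℂ) (e (f (φ (N + 1))))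
    (T (e (f (φ (N + 1)))) - T (e (f (φ N))))
  rw [h0, he.1, one_mul] at h1
  simp only [Function.comp_apply, dist_eq_norm] at hlt
  linarith

/-- The resolvent of a normal operator is normal. -/
theorem Op.IsNormalOp.isStarNormal_of_isResolventAt {H : Type*} [NormedAddCommGroup H]
    [InnerProductSpace ℂ H] [CompleteSpace H] {G : Op H} (hG : G.IsNormalOp) {z : ℂ}
    {N : H →L[ℂ] H} (hN : G.IsResolventAt z N) : IsStarNormal N := by
  obtain ⟨hdense, -, Gs, ⟨hdom, hadj⟩, hdomeq, hnorm⟩ := hG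
  obtain ⟨hN1, hN2, hN3⟩ := hN
  set N' := ContinuousLinearMap.adjoint N with hN'
  have hmem : ∀ y, N' y ∈ Gs.dom ∧ Gs.app (N' y) = y + starRingEnd ℂ z • N' y := by
    intro y
    have key : ∀ x ∈ G.dom, ⟪G.app x, N' y⟫_ℂ = ⟪x, y + starRingEnd ℂ z • N' y⟫_ℂ := by
      intro x hx
      have h1 : N (G.app x) = x + z • N x := by
        have := hN3 x hx
        rw [map_sub, map_smul] at this
        exact sub_eq_iff_eq_add.1 this
      rw [hN', ContinuousLinearMap.adjoint_inner_right, h1, inner_add_left, inner_smul_left,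
        inner_add_right, inner_smul_right, ContinuousLinearMap.adjoint_inner_right]
    have h1 : N' y ∈ Gs.dom := by
      rw [← SetLike.mem_coe, hdom]
      exact ⟨_, key⟩
    refine ⟨h1, ?_⟩
    refine hdense.eq_of_inner_right (𝕜 := ℂ) fun x hx => ?_
    rw [← hadj _ h1 x hx, key x hx]
  have hnorm' : ∀ u ∈ G.dom, ‖G.app u - z • u‖ = ‖Gs.app u - starRingEnd ℂ z • u‖ := by
    intro u hu
    have h1 : ⟪G.app u, u⟫_ℂ = ⟪u, Gs.app u⟫_ℂ := hadj u (hdomeq ▸ hu) u hu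
    have h2 : ‖G.app u - z • u‖ ^ 2 = ‖Gs.app u - starRingEnd ℂ z • u‖ ^ 2 := by
      rw [norm_sub_sq (𝕜 := ℂ), norm_sub_sq (𝕜 := ℂ), hnorm u hu, norm_smul, norm_smul,
        RCLike.norm_conj, inner_smul_right, inner_smul_right, h1, ← inner_conj_symm (Gs.app u) u,
        ← map_mul, RCLike.conj_re]
    exact (sq_eq_sq₀ (norm_nonneg _) (norm_nonneg _)).1 h2
  let U : H →ₗᵢ[ℂ] H :=
    ⟨(Gs.app - starRingEnd ℂ z • LinearMap.id) ∘ₗ (N : H →ₗ[ℂ] H), fun x => by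
      change ‖Gs.app (N x) - starRingEnd ℂ z • N x‖ = ‖x‖
      rw [← hnorm' _ (hN1 x), hN2]⟩
  have hU : ∀ x, U x = Gs.app (N x) - starRingEnd ℂ z • N x := fun x => rfl
  have hN'dom : ∀ y, N' y ∈ G.dom := fun y => hdomeq ▸ (hmem y).1
  have hUV : ∀ y, U (G.app (N' y) - z • N' y) = y := by
    intro y
    rw [hU, hN3 _ (hN'dom y), (hmem y).2]
    simp
  have hV : ∀ w, G.app (N' (N w)) - z • N' (N w) = N' w := by
    intro w
    refine ext_inner_left ℂ fun x => ?_
    rw [← U.inner_map_map, hUV, hU, inner_sub_left, inner_smul_left]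
    have h1 : ⟪Gs.app (N x), N w⟫_ℂ = ⟪N x, G.app (N w)⟫_ℂ := by
      rw [← inner_conj_symm, ← hadj _ (hdomeq ▸ hN1 x) _ (hN1 w), inner_conj_symm]
    rw [h1, RCLike.conj_conj, ← inner_smul_right, ← inner_sub_right, hN2, hN',
      ContinuousLinearMap.adjoint_inner_right]
  refine ContinuousLinearMap.isStarNormal_iff_norm_eq_adjoint.2 fun w => ?_
  rw [← hN', ← hV, hnorm' _ (hN'dom _), (hmem _).2]
  simp

/-- A normal operator with compact resolvent is diagonal in an orthonormal basis. -/
theorem Op.IsNormalOp.exists_hilbertBasis {H : Type*} [NormedAddCommGroup H]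
    [InnerProductSpace ℂ H] [CompleteSpace H] {G : Op H} (hG : G.IsNormalOp)
    (hGres : G.HasCompactResolvent) :
    ∃ (ι : Type) (e : HilbertBasis ι ℂ H) (ν : ι → ℂ),
      (∀ i, e i ∈ G.dom ∧ G.app (e i) = ν i • e i) ∧
      (∀ u ∈ G.dom, ∀ i, e.repr (G.app u) i = ν i * e.repr u i) ∧
      (∀ x y : H, (∀ i, e.repr y i = ν i * e.repr x i) → x ∈ G.dom) ∧
      ∀ C : ℝ, {i | ‖ν i‖ ≤ C}.Finite := by
  obtain ⟨z, N, hN, hNc⟩ := hGres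
  have hnormal := hG.isStarNormal_of_isResolventAt hN
  obtain ⟨hN1, hN2, hN3⟩ := hN
  have hinj : ∀ x, N x = 0 → x = 0 := by
    intro x hx
    have := hN2 x
    rw [hx] at this
    simpa using this.symm
  obtain ⟨ι, e, μ, hμ⟩ := hnormal.exists_hilbertBasis hNc hinj
  have hrepr : ∀ w i, e.repr (N w) i = μ i * e.repr w i := by
    intro w i
    rw [HilbertBasis.repr_apply_apply, HilbertBasis.repr_apply_apply,
      ← ContinuousLinearMap.adjoint_inner_left, hnormal.adjoint_apply_eq_of_apply_eq (hμ i).2,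
      inner_smul_left, RCLike.conj_conj]
  have hdom : ∀ i, e i ∈ G.dom := by
    intro i
    have h1 : e i = (μ i)⁻¹ • N (e i) := by rw [(hμ i).2, inv_smul_smul₀ (hμ i).1]
    rw [h1]
    exact Submodule.smul_mem _ _ (hN1 _)
  refine ⟨ι, e, fun i => z + (μ i)⁻¹, fun i => ⟨hdom i, ?_⟩, fun u hu i => ?_, fun x y hxy => ?_,
    fun C => ?_⟩
  · have h1 := hN2 (e i)
    rw [(hμ i).2, map_smul, smul_comm z, ← smul_sub] at h1
    have h2 : G.app (e i) - z • e i = (μ i)⁻¹ • e i := by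
      rw [← h1, inv_smul_smul₀ (hμ i).1, h1]
    rw [add_smul, ← h2]
    abel
  · have h1 := hrepr (G.app u - z • u) i
    rw [hN3 u hu, map_sub, map_smul] at h1
    simp only [lp.coeFn_sub, lp.coeFn_smul, Pi.sub_apply, Pi.smul_apply, smul_eq_mul] at h1
    have := (hμ i).1
    field_simp
    linear_combination (-1 : ℂ) * h1
  · have h1 : N (y - z • x) = x := by
      refine e.repr.injective (lp.ext (funext fun i => ?_))
      rw [hrepr, map_sub, map_smul]
      simp only [lp.coeFn_sub, lp.coeFn_smul, Pi.sub_apply, Pi.smul_apply, smul_eq_mul, hxy i]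
      have := (hμ i).1
      field_simp
      ring
    rw [← h1]
    exact hN1 _
  · have hpos : 0 < (|C| + ‖z‖ + 1)⁻¹ := by positivity
    refine (hNc.finite_setOf_le_norm e.orthonormal (fun i => (hμ i).2) hpos).subset fun i hi => ?_
    change (|C| + ‖z‖ + 1)⁻¹ ≤ ‖μ i‖
    change ‖z + (μ i)⁻¹‖ ≤ C at hi
    refine inv_le_of_inv_le₀ (norm_pos_iff.2 (hμ i).1) ?_
    rw [← norm_inv]
    have h1 : ‖(μ i)⁻¹‖ ≤ ‖z + (μ i)⁻¹‖ + ‖z‖ := by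
      have := norm_sub_le (z + (μ i)⁻¹) z
      rwa [add_sub_cancel_left] at this
    linarith [le_abs_self C]

theorem Op.mem_spec_of_app_eq_smul {H : Type*} [NormedAddCommGroup H]
    [InnerProductSpace ℂ H] {G : Op H} {z : ℂ} {x : H} (hx : x ∈ G.dom) (hx0 : x ≠ 0)
    (h : G.app x = z • x) : z ∈ G.spec := by
  rintro ⟨R, -, -, hR⟩
  have := hR x hx
  rw [h, sub_self, map_zero] at this
  exact hx0 this.symm

theorem HilbertBasis.norm_le_mul_norm {ι H : Type*} [NormedAddCommGroup H]
    [InnerProductSpace ℂ H] (e : HilbertBasis ι ℂ H) {C : ℝ} (hC : 0 ≤ C) {x y : H}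
    (h : ∀ i, ‖e.repr y i‖ ≤ C * ‖e.repr x i‖) : ‖y‖ ≤ C * ‖x‖ := by
  have h1 : ‖e.repr y‖ ≤ ‖(C : ℂ) • e.repr x‖ := by
    refine lp.norm_mono two_ne_zero fun i => ?_
    rw [lp.coeFn_smul, Pi.smul_apply, norm_smul, Complex.norm_of_nonneg hC]
    exact h i
  rwa [norm_smul, Complex.norm_of_nonneg hC, e.repr.norm_map, e.repr.norm_map] at h1

theorem HilbertBasis.ext_repr {ι H : Type*} [NormedAddCommGroup H]
    [InnerProductSpace ℂ H] (e : HilbertBasis ι ℂ H) {x y : H}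
    (h : ∀ i, e.repr x i = e.repr y i) : x = y :=
  e.repr.injective (lp.ext (funext h))

/-- Bounded sequences act diagonally. -/
theorem HilbertBasis.exists_diagonal {ι H : Type*} [NormedAddCommGroup H]
    [InnerProductSpace ℂ H] (e : HilbertBasis ι ℂ H) {C : ℝ} (hC : 0 ≤ C) {d : ι → ℂ}
    (hd : ∀ i, ‖d i‖ ≤ C) :
    ∃ D : H →L[ℂ] H, (∀ x i, e.repr (D x) i = d i * e.repr x i) ∧ ∀ x, ‖D x‖ ≤ C * ‖x‖ := by
  have hmem : ∀ x, Memℓp (fun i => d i * e.repr x i) 2 := fun x => by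
    refine (lp.memℓp ((C : ℂ) • e.repr x)).mono' fun i => ?_
    rw [lp.coeFn_smul, Pi.smul_apply, norm_smul, Complex.norm_of_nonneg hC, norm_mul]
    exact mul_le_mul_of_nonneg_right (hd i) (norm_nonneg _)
  let f : H → H := fun x => e.repr.symm ⟨_, hmem x⟩
  have hf : ∀ x i, e.repr (f x) i = d i * e.repr x i := fun x i => by
    simp [f]
  let L : H →ₗ[ℂ] H :=
    { toFun := f
      map_add' := fun x y => e.ext_repr fun i => by
        rw [hf, map_add, map_add, lp.coeFn_add, lp.coeFn_add, Pi.add_apply, Pi.add_apply, hf, hf,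
          mul_add]
      map_smul' := fun c x => e.ext_repr fun i => by
        rw [hf, map_smul, RingHom.id_apply, map_smul, lp.coeFn_smul, lp.coeFn_smul, Pi.smul_apply,
          Pi.smul_apply, hf, smul_eq_mul, smul_eq_mul]
        ring }
  have hL : ∀ x, ‖L x‖ ≤ C * ‖x‖ := fun x => e.norm_le_mul_norm hC fun i => by
    change ‖e.repr (f x) i‖ ≤ _
    rw [hf, norm_mul]
    exact mul_le_mul_of_nonneg_right (hd i) (norm_nonneg _)
  exact ⟨L.mkContinuous C hL, hf, hL⟩

namespace Op

variable {H : Type*} [NormedAddCommGroup H] [InnerProductSpace ℂ H]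

/-- `G` acts as multiplication by `ν` in the coordinates of `e`, on its maximal domain. -/
structure IsDiagonal {ι : Type*} (G : Op H) (e : HilbertBasis ι ℂ H) (ν : ι → ℂ) : Prop where
  basis_mem : ∀ i, e i ∈ G.dom
  app_basis : ∀ i, G.app (e i) = ν i • e i
  repr_app : ∀ u ∈ G.dom, ∀ i, e.repr (G.app u) i = ν i * e.repr u i
  mem_dom : ∀ x y : H, (∀ i, e.repr y i = ν i * e.repr x i) → x ∈ G.dom

/-- The operator `T + K` for a bounded operator `K`. -/
def perturb (T : Op H) (K : H →L[ℂ] H) : Op H := ⟨T.dom, T.app + K⟩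

theorem IsResolventAt.unique {T : Op H} {z : ℂ} {R R' : H →L[ℂ] H} (h : T.IsResolventAt z R)
    (h' : T.IsResolventAt z R') : R = R' := by
  ext x
  rw [← h'.2.2 _ (h.1 x), h.2.1]

/-- The Neumann series for a subordinate perturbation of a diagonal operator. -/
theorem IsDiagonal.exists_isResolventAt [CompleteSpace H] {ι : Type*} {G S : Op H}
    {e : HilbertBasis ι ℂ H} {ν : ι → ℂ} (hG : G.IsDiagonal e ν) {p b : ℝ} (hp0 : 0 ≤ p)
    (hp1 : p ≤ 1) (hb : 0 ≤ b) (hS : S.Subordinate G p b) {K : H →L[ℂ] H} {κ : ι → ℂ}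
    (hK : ∀ x i, e.repr (K x) i = κ i * e.repr x i) {z : ℂ} {d q : ℝ} (hd : 0 < d)
    (hdist : ∀ i, d ≤ ‖ν i + κ i - z‖) (hκ : ∀ i, ‖ν i‖ ≤ ‖ν i + κ i‖)
    (hq : q < 1) (hbq : b * (d + ‖z‖) ^ p ≤ q * d) :
    ∃ R : H →L[ℂ] H, ((G.addOp S).perturb K).IsResolventAt z R ∧
      (∀ x, ‖R x‖ ≤ 1 / (d * (1 - q)) * ‖x‖) ∧ ∀ x, ‖S.app (R x)‖ ≤ q / (1 - q) * ‖x‖ := by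
  have hq0 : 0 ≤ q := by
    by_contra! h
    have h1 : q * d < 0 := mul_neg_of_neg_of_pos h hd
    have h2 : 0 ≤ b * (d + ‖z‖) ^ p := by positivity
    linarith
  have hne : ∀ i, ν i + κ i - z ≠ 0 := fun i => norm_pos_iff.1 (hd.trans_le (hdist i))
  have hinv : ∀ i, ‖(ν i + κ i - z)⁻¹‖ ≤ d⁻¹ := fun i => by
    rw [norm_inv]
    exact inv_anti₀ hd (hdist i)
  obtain ⟨D, hD, hDn⟩ := e.exists_diagonal (inv_nonneg.2 hd.le) hinv
  have hdiv : ∀ i, ‖ν i * (ν i + κ i - z)⁻¹‖ ≤ (d + ‖z‖) * d⁻¹ := fun i => by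
    have h0 := hd.trans_le (hdist i)
    rw [norm_mul, norm_inv, ← div_eq_mul_inv, ← div_eq_mul_inv, div_le_div_iff₀ h0 hd]
    have h1 : ‖ν i‖ ≤ ‖ν i + κ i - z‖ + ‖z‖ :=
      (hκ i).trans (by simpa using norm_add_le (ν i + κ i - z) z)
    nlinarith [norm_nonneg z, hdist i]
  obtain ⟨L, hL, hLn⟩ := e.exists_diagonal (by positivity) hdiv
  have hDdom : ∀ x, D x ∈ G.dom := fun x => hG.mem_dom _ (L x) fun i => by
    rw [hL, hD, mul_assoc]
  have hGD : ∀ x, G.app (D x) = L x := fun x => e.ext_repr fun i => by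
    rw [hG.repr_app _ (hDdom x), hD, hL, mul_assoc]
  have hSD : ∀ x, ‖S.app (D x)‖ ≤ q * ‖x‖ := by
    intro x
    refine (hS.2 _ (hDdom x)).trans ?_
    rw [hGD]
    have h1 : ‖D x‖ ^ (1 - p) ≤ (d⁻¹ * ‖x‖) ^ (1 - p) :=
      Real.rpow_le_rpow (norm_nonneg _) (hDn x) (by linarith)
    have h2 : ‖L x‖ ^ p ≤ ((d + ‖z‖) * (d⁻¹ * ‖x‖)) ^ p :=
      Real.rpow_le_rpow (norm_nonneg _) ((hLn x).trans_eq (mul_assoc _ _ _)) hp0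
    calc b * ‖D x‖ ^ (1 - p) * ‖L x‖ ^ p
        ≤ b * (d⁻¹ * ‖x‖) ^ (1 - p) * ((d + ‖z‖) * (d⁻¹ * ‖x‖)) ^ p := by gcongr
      _ = b * (d + ‖z‖) ^ p * (d⁻¹ * ‖x‖) := by
        have h0 : 0 ≤ d⁻¹ * ‖x‖ := by positivity
        rw [Real.mul_rpow (by positivity) h0]
        have h3 : (d⁻¹ * ‖x‖) ^ (1 - p) * (d⁻¹ * ‖x‖) ^ p = d⁻¹ * ‖x‖ := by
          rw [← Real.rpow_add_of_nonneg h0 (by linarith) hp0]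
          simp
        linear_combination (b * (d + ‖z‖) ^ p) * h3
      _ ≤ q * d * (d⁻¹ * ‖x‖) := by gcongr
      _ = q * ‖x‖ := by field_simp
  let B : H →L[ℂ] H := (-(S.app ∘ₗ (D : H →ₗ[ℂ] H))).mkContinuous q fun x => by
    rw [LinearMap.neg_apply, norm_neg]
    exact hSD x
  have hBapp : ∀ x, B x = -S.app (D x) := fun x => rfl
  have hBn : ‖B‖ < 1 := (LinearMap.mkContinuous_norm_le _ hq0 _).trans_lt hq
  set W : H →L[ℂ] H := (((Units.oneSub B hBn)⁻¹ : (H →L[ℂ] H)ˣ) : H →L[ℂ] H) with hW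
  have hW1 : ∀ x, W x + S.app (D (W x)) = x := fun x => by
    have h1 := DFunLike.congr_fun (Units.oneSub B hBn).mul_inv x
    simpa [hBapp] using h1
  have hW2 : ∀ x, W (x + S.app (D x)) = x := fun x => by
    have h1 := DFunLike.congr_fun (Units.oneSub B hBn).inv_mul x
    simpa [hBapp] using h1
  have hWn : ∀ x, ‖W x‖ ≤ 1 / (1 - q) * ‖x‖ := fun x => by
    have h1 : W x = x - S.app (D (W x)) := eq_sub_of_add_eq (hW1 x)
    have h2 : ‖W x‖ ≤ ‖x‖ + q * ‖W x‖ := by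
      conv_lhs => rw [h1]
      exact (norm_sub_le _ _).trans (by gcongr; exact hSD _)
    rw [div_mul_eq_mul_div, one_mul, le_div_iff₀ (by linarith)]
    linarith
  have hGK : ∀ x, L x + K (D x) - z • D x = x := fun x => e.ext_repr fun i => by
    rw [map_sub, map_add, map_smul]
    simp only [lp.coeFn_sub, lp.coeFn_add, lp.coeFn_smul, Pi.sub_apply, Pi.add_apply,
      Pi.smul_apply, smul_eq_mul, hL, hK, hD]
    have := hne i
    field_simp
  refine ⟨D ∘L W, ⟨fun x => hDdom _, fun x => ?_, fun u hu => ?_⟩, fun x => ?_, fun x => ?_⟩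
  · change G.app (D (W x)) + S.app (D (W x)) + K (D (W x)) - z • D (W x) = x
    rw [hGD]
    calc _ = (L (W x) + K (D (W x)) - z • D (W x)) + S.app (D (W x)) := by abel
      _ = x := by rw [hGK, hW1]
  · change D (W (G.app u + S.app u + K u - z • u)) = u
    set w := G.app u + K u - z • u with hw
    have hDw : D w = u := e.ext_repr fun i => by
      rw [hD, hw, map_sub, map_add, map_smul]
      simp only [lp.coeFn_sub, lp.coeFn_add, lp.coeFn_smul, Pi.sub_apply, Pi.add_apply,
        Pi.smul_apply, smul_eq_mul, hG.repr_app u hu, hK]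
      have := hne i
      field_simp
    have h1 : G.app u + S.app u + K u - z • u = w + S.app (D w) := by
      rw [hDw, hw]
      abel
    rw [h1, hW2, hDw]
  · change ‖D (W x)‖ ≤ _
    refine (hDn _).trans ?_
    calc d⁻¹ * ‖W x‖ ≤ d⁻¹ * (1 / (1 - q) * ‖x‖) := by gcongr; exact hWn x
      _ = 1 / (d * (1 - q)) * ‖x‖ := by
        field_simp
  · change ‖S.app (D (W x))‖ ≤ _
    refine (hSD _).trans ?_
    calc q * ‖W x‖ ≤ q * (1 / (1 - q) * ‖x‖) := by gcongr; exact hWn x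
      _ = q / (1 - q) * ‖x‖ := by ring

/-- A locally bounded resolvent is holomorphic. -/
theorem differentiableOn_of_isResolventAt {T : Op H} {U : Set ℂ} {R : ℂ → H →L[ℂ] H} {M : ℝ}
    (hU : IsOpen U) (hR : ∀ z ∈ U, T.IsResolventAt z (R z)) (hM : ∀ z ∈ U, ‖R z‖ ≤ M) :
    DifferentiableOn ℂ R U := by
  have hid : ∀ z ∈ U, ∀ w ∈ U, R z - R w = (z - w) • (R w * R z) := by
    intro z hz w hw
    ext x
    have h1 := (hR z hz).2.1 x
    have h2 := (hR w hw).2.2 _ ((hR z hz).1 x)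
    have h3 : T.app (R z x) - w • R z x = x + (z - w) • R z x := by
      calc _ = (T.app (R z x) - z • R z x) + (z - w) • R z x := by
            rw [sub_smul]
            abel
        _ = _ := by rw [h1]
    rw [h3, map_add, map_smul] at h2
    change R z x - R w x = (z - w) • R w (R z x)
    exact sub_eq_of_eq_add' h2.symm
  intro w hw
  have hM0 : 0 ≤ M := (norm_nonneg _).trans (hM w hw)
  have hcont : Tendsto R (nhdsWithin w {w}ᶜ) (nhds (R w)) := by
    rw [tendsto_iff_norm_sub_tendsto_zero]
    have hlim : Tendsto (fun z => ‖z - w‖ * (M * M)) (nhdsWithin w {w}ᶜ) (nhds 0) := by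
      have : ContinuousAt (fun z : ℂ => ‖z - w‖ * (M * M)) w := by fun_prop
      have h := this.tendsto.mono_left (nhdsWithin_le_nhds (s := {w}ᶜ))
      simpa using h
    refine squeeze_zero' (Eventually.of_forall fun z => norm_nonneg _) ?_ hlim
    filter_upwards [nhdsWithin_le_nhds (hU.mem_nhds hw)] with z hz
    rw [hid z hz w hw, norm_smul]
    gcongr
    exact (norm_mul_le _ _).trans (mul_le_mul (hM w hw) (hM z hz) (norm_nonneg _) hM0)
  refine DifferentiableAt.differentiableWithinAt (HasDerivAt.differentiableAt (f' := R w * R w) ?_)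
  rw [hasDerivAt_iff_tendsto_slope]
  refine Tendsto.congr' ?_ (hcont.const_mul (R w))
  filter_upwards [nhdsWithin_le_nhds (hU.mem_nhds hw), self_mem_nhdsWithin] with z hz hzw
  rw [slope, vsub_eq_sub, hid z hz w hw, inv_smul_smul₀ (sub_ne_zero.2 hzw)]

end Op

theorem ContinuousLinearMap.norm_det_le {V : Type*} [NormedAddCommGroup V]
    [InnerProductSpace ℂ V] [FiniteDimensional ℂ V] (A : V →L[ℂ] V) {C : ℝ}
    (hA : ∀ x, ‖A x‖ ≤ C * ‖x‖) :
    ‖LinearMap.det (A : V →ₗ[ℂ] V)‖ ≤ C ^ Module.finrank ℂ V := by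
  set f : Module.End ℂ V := (A : V →ₗ[ℂ] V) with hf
  have hs : f.charpoly.Splits := IsAlgClosed.splits _
  rw [Module.End.det_eq_prod_roots_charpoly_of_splits hs]
  have hcard : f.charpoly.roots.card = Module.finrank ℂ V := by
    rw [← hs.natDegree_eq_card_roots, LinearMap.charpoly_natDegree]
  have hroot : ∀ μ ∈ f.charpoly.roots, ‖μ‖ ≤ C := by
    intro μ hμ
    have h1 : f.HasEigenvalue μ := by
      rw [Module.End.hasEigenvalue_iff_isRoot_charpoly]
      exact (Polynomial.mem_roots'.1 hμ).2
    obtain ⟨v, hv⟩ := h1.exists_hasEigenvector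
    have h2 := hA v
    have h3 : A v = μ • v := hv.apply_eq_smul
    rw [h3, norm_smul] at h2
    exact le_of_mul_le_mul_right h2 (norm_pos_iff.2 hv.2)
  rw [← hcard]
  generalize f.charpoly.roots = m at hroot
  induction m using Multiset.induction_on with
  | empty => simp
  | cons a m ih =>
    rw [Multiset.prod_cons, norm_mul, Multiset.card_cons, pow_succ']
    have h1 := hroot a (Multiset.mem_cons_self a m)
    exact mul_le_mul h1 (ih fun μ hμ => hroot μ (Multiset.mem_cons_of_mem hμ)) (norm_nonneg _)
      ((norm_nonneg _).trans h1)

/-- A lower bound for a linear map in terms of its determinant. -/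
theorem ContinuousLinearMap.norm_det_mul_norm_le {V : Type*} [NormedAddCommGroup V]
    [InnerProductSpace ℂ V] [FiniteDimensional ℂ V] (A : V →L[ℂ] V) {C : ℝ} (hC : 0 ≤ C)
    (hA : ∀ x, ‖A x‖ ≤ C * ‖x‖) (x : V) :
    ‖LinearMap.det (A : V →ₗ[ℂ] V)‖ * ‖x‖ ≤ (2 * C + 1) ^ Module.finrank ℂ V * ‖A x‖ := by
  by_cases hx : x = 0
  · simp [hx]
  by_cases hAx : A x = 0
  · have : LinearMap.det (A : V →ₗ[ℂ] V) = 0 := by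
      by_contra h
      have hu : IsUnit (A : V →ₗ[ℂ] V) := (LinearMap.isUnit_iff_isUnit_det _).2 (Ne.isUnit h)
      have hi := ((Module.End.isUnit_iff _).1 hu).1
      exact hx (hi (by simpa using hAx))
    simp [this, hAx]
  have hx0 : 0 < ‖x‖ := norm_pos_iff.2 hx
  have hAx0 : 0 < ‖A x‖ := norm_pos_iff.2 hAx
  set s : ℝ := ‖x‖ / ‖A x‖ with hs
  set c : ℂ := (((s - 1) / ‖x‖ ^ 2 : ℝ) : ℂ) with hc
  let P : V →ₗ[ℂ] V := LinearMap.transvection (c • (innerSL ℂ x : V →ₗ[ℂ] ℂ)) x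
  have hPapp : ∀ y, P y = y + (c * ⟪x, y⟫_ℂ) • x := fun y => by
    simp [P, LinearMap.transvection.apply]
  have hPdet : LinearMap.det P = s := by
    have h1 := LinearMap.transvection.det (c • (innerSL ℂ x : V →ₗ[ℂ] ℂ)) x
    rw [h1]
    simp only [LinearMap.smul_apply, ContinuousLinearMap.coe_coe, innerSL_apply_apply,
      inner_self_eq_norm_sq_to_K, smul_eq_mul, hc]
    have : (‖x‖ : ℂ) ≠ 0 := by exact_mod_cast hx0.ne'
    push_cast
    change 1 + ((s : ℂ) - 1) / (‖x‖ : ℂ) ^ 2 * (‖x‖ : ℂ) ^ 2 = s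
    field_simp
    ring
  let AP : V →L[ℂ] V := LinearMap.toContinuousLinearMap ((A : V →ₗ[ℂ] V) ∘ₗ P)
  have hAP : ∀ y, ‖AP y‖ ≤ (2 * C + 1) * ‖y‖ := by
    intro y
    change ‖A (P y)‖ ≤ _
    rw [hPapp, map_add, map_smul]
    have h1 : ‖(c * ⟪x, y⟫_ℂ) • A x‖ ≤ (1 + C) * ‖y‖ := by
      rw [norm_smul, norm_mul, hc, Complex.norm_real, Real.norm_eq_abs, abs_div,
        abs_of_pos (by positivity : (0 : ℝ) < ‖x‖ ^ 2)]
      have h2 := norm_inner_le_norm (𝕜 := ℂ) x y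
      have h3 : |s - 1| * ‖A x‖ ≤ (1 + C) * ‖x‖ := by
        have h4 : |s - 1| * ‖A x‖ = |(s - 1) * ‖A x‖| := by rw [abs_mul, abs_of_pos hAx0]
        rw [h4, sub_mul, one_mul, hs,
          div_mul_cancel₀ _ hAx0.ne', abs_le]
        constructor <;> nlinarith [hA x]
      calc |s - 1| / ‖x‖ ^ 2 * ‖⟪x, y⟫_ℂ‖ * ‖A x‖
          ≤ |s - 1| / ‖x‖ ^ 2 * (‖x‖ * ‖y‖) * ‖A x‖ := by gcongr
        _ = (|s - 1| * ‖A x‖) * (‖y‖ / ‖x‖) := by field_simp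
        _ ≤ (1 + C) * ‖x‖ * (‖y‖ / ‖x‖) := by gcongr
        _ = (1 + C) * ‖y‖ := by field_simp
    calc _ ≤ ‖A y‖ + ‖(c * ⟪x, y⟫_ℂ) • A x‖ := norm_add_le _ _
      _ ≤ C * ‖y‖ + (1 + C) * ‖y‖ := add_le_add (hA y) h1
      _ = _ := by ring
  have h4 := AP.norm_det_le hAP
  have h5 : LinearMap.det (AP : V →ₗ[ℂ] V) = LinearMap.det (A : V →ₗ[ℂ] V) * s := by
    rw [← hPdet, ← LinearMap.det_comp]
    rfl
  rw [h5, norm_mul, Complex.norm_of_nonneg (by positivity), hs, mul_div_assoc',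
    div_le_iff₀ hAx0] at h4
  exact h4

theorem ContinuousLinearMap.differentiableOn_det {V : Type*} [NormedAddCommGroup V]
    [InnerProductSpace ℂ V] [FiniteDimensional ℂ V] {A : ℂ → V →L[ℂ] V} {U : Set ℂ}
    (hA : DifferentiableOn ℂ A U) :
    DifferentiableOn ℂ (fun z => LinearMap.det (A z : V →ₗ[ℂ] V)) U := by
  let b := stdOrthonormalBasis ℂ V
  have h1 : ∀ z, LinearMap.det (A z : V →ₗ[ℂ] V) =
      (Matrix.of fun i j => ⟪b i, A z (b j)⟫_ℂ).det := fun z => by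
    rw [← LinearMap.det_toMatrix b.toBasis]
    congr 1
    ext i j
    simp [LinearMap.toMatrix_apply, OrthonormalBasis.repr_apply_apply]
  simp_rw [h1, Matrix.det_apply]
  refine DifferentiableOn.fun_sum fun σ _ => DifferentiableOn.const_smul ?_ _
  refine DifferentiableOn.fun_finsetProd fun i _ => ?_
  exact (innerSL ℂ (b (σ i))).differentiable.comp_differentiableOn
    (hA.clm_apply (differentiableOn_const _))

namespace Op

variable {H : Type*} [NormedAddCommGroup H] [InnerProductSpace ℂ H]

/-- The compression to `V` of `1 - K R`, for an operator `K` with range in `V`. -/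
noncomputable def compression {V : Submodule ℂ H} (K : H →L[ℂ] V) (R : H →L[ℂ] H) : V →L[ℂ] V :=
  1 - K ∘L R ∘L V.subtypeL

theorem compression_apply {V : Submodule ℂ H} (K : H →L[ℂ] V) (R : H →L[ℂ] H) (v : V) :
    compression K R v = v - K (R v) := rfl

/-- A finite rank perturbation can be removed when the compression is invertible. -/
theorem IsResolventAt.exists_of_perturb {T : Op H} {V : Submodule ℂ H} [FiniteDimensional ℂ V]
    {K : H →L[ℂ] V} {z : ℂ} {R : H →L[ℂ] H}
    (hR : (T.perturb (V.subtypeL ∘L K)).IsResolventAt z R) {ε c : ℝ} (hε : 0 < ε)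
    (hA : ∀ v, ε * ‖v‖ ≤ ‖compression K R v‖) (hc : ∀ x, ‖K (R x)‖ ≤ c * ‖x‖) :
    ∃ W : H →L[ℂ] H, T.IsResolventAt z (R ∘L W) ∧ ∀ x, ‖W x‖ ≤ (1 + c / ε) * ‖x‖ := by
  obtain ⟨h1, h2, h3⟩ := hR
  change ∀ x, R x ∈ T.dom at h1
  change ∀ x, T.app (R x) + (K (R x) : H) - z • R x = x at h2
  change ∀ x ∈ T.dom, R (T.app x + (K x : H) - z • x) = x at h3
  have hinj : Function.Injective (compression K R : V →ₗ[ℂ] V) := by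
    rw [← LinearMap.ker_eq_bot, LinearMap.ker_eq_bot']
    intro v hv
    have := hA v
    rw [show compression K R v = 0 from hv, norm_zero] at this
    exact norm_eq_zero.1 (le_antisymm (nonpos_of_mul_nonpos_right this hε) (norm_nonneg _))
  let A := LinearEquiv.ofInjectiveEndo _ hinj
  let B : V →L[ℂ] V := LinearMap.toContinuousLinearMap (A.symm : V →ₗ[ℂ] V)
  have hAB : ∀ v : V, B v - K (R (B v)) = v := fun v => A.apply_symm_apply v
  have hBA : ∀ v : V, B (v - K (R v)) = v := fun v => A.symm_apply_apply v
  have hB : ∀ v, ‖B v‖ ≤ ‖v‖ / ε := fun v => by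
    rw [le_div_iff₀' hε]
    have := hA (B v)
    rwa [compression_apply, hAB] at this
  let W : H →L[ℂ] H := 1 + V.subtypeL ∘L B ∘L K ∘L R
  have hW : ∀ x, W x = x + (B (K (R x)) : H) := fun x => rfl
  have hW1 : ∀ x, W x - (K (R (W x)) : H) = x := fun x => by
    have h4 := congrArg (Subtype.val) (hAB (K (R x)))
    rw [Submodule.coe_sub] at h4
    rw [hW, map_add, map_add, Submodule.coe_add]
    linear_combination (norm := module) h4
  have hW2 : ∀ x, W (x - (K (R x) : H)) = x := fun x => by
    rw [hW, map_sub, map_sub, hBA]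
    abel
  refine ⟨W, ⟨fun x => h1 _, fun x => ?_, fun x hx => ?_⟩, fun x => ?_⟩
  · change T.app (R (W x)) - z • R (W x) = x
    have h4 := h2 (W x)
    have h5 := hW1 x
    linear_combination (norm := module) h4 + h5
  · change R (W (T.app x - z • x)) = x
    have h4 := h3 x hx
    set w := T.app x + (K x : H) - z • x with hw
    have h5 : T.app x - z • x = w - (K (R w) : H) := by
      rw [h4, hw]
      abel
    rw [h5, hW2, h4]
  · rw [hW]
    calc _ ≤ ‖x‖ + ‖B (K (R x))‖ := norm_add_le _ _
      _ ≤ ‖x‖ + c * ‖x‖ / ε := by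
        gcongr
        exact (hB _).trans (div_le_div_of_nonneg_right (hc x) hε.le)
      _ = _ := by ring

/-- A lower bound for the determinant of the compression at a point of the resolvent set. -/
theorem IsResolventAt.one_le_norm_det_compression {T : Op H} {V : Submodule ℂ H}
    [FiniteDimensional ℂ V] {K : H →L[ℂ] V} {z : ℂ} {R R' : H →L[ℂ] H}
    (hR : (T.perturb (V.subtypeL ∘L K)).IsResolventAt z R) (hR' : T.IsResolventAt z R') {c : ℝ}
    (hc : ∀ x, ‖K (R' x)‖ ≤ c * ‖x‖) :
    1 ≤ ‖LinearMap.det (compression K R : V →ₗ[ℂ] V)‖ * (1 + c) ^ Module.finrank ℂ V := by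
  have h3 : ∀ x ∈ T.dom, R (T.app x + (K x : H) - z • x) = x := hR.2.2
  have hid : ∀ x, R' x = R x + R (K (R' x)) := fun x => by
    have h4 := h3 _ (hR'.1 x)
    rw [← map_add]
    conv_lhs => rw [← h4]
    congr 1
    linear_combination (norm := module) hR'.2.1 x
  let D : V →L[ℂ] V := 1 + K ∘L R' ∘L V.subtypeL
  have hD : ∀ v : V, D v = v + K (R' v) := fun v => rfl
  have hcomp : (compression K R : V →ₗ[ℂ] V) ∘ₗ (D : V →ₗ[ℂ] V) = LinearMap.id := by
    refine LinearMap.ext fun v => ?_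
    change compression K R (D v) = v
    rw [compression_apply, hD, Submodule.coe_add, map_add, ← hid]
    abel
  have hdet := congrArg LinearMap.det hcomp
  rw [LinearMap.det_comp, LinearMap.det_id] at hdet
  have h5 : ‖LinearMap.det (D : V →ₗ[ℂ] V)‖ ≤ (1 + c) ^ Module.finrank ℂ V :=
    D.norm_det_le fun v => by
      rw [hD]
      calc _ ≤ ‖v‖ + ‖K (R' v)‖ := norm_add_le _ _
        _ ≤ ‖v‖ + c * ‖v‖ := by gcongr; exact hc _
        _ = _ := by ring
  calc (1 : ℝ) = ‖LinearMap.det (compression K R : V →ₗ[ℂ] V)‖ *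
        ‖LinearMap.det (D : V →ₗ[ℂ] V)‖ := by rw [← norm_mul, hdet, norm_one]
    _ ≤ _ := by gcongr

end Op

theorem Op.differentiableOn_compression {H : Type*} [NormedAddCommGroup H]
    [InnerProductSpace ℂ H] {V : Submodule ℂ H} (K : H →L[ℂ] V) {R : ℂ → H →L[ℂ] H} {U : Set ℂ}
    (hR : DifferentiableOn ℂ R U) : DifferentiableOn ℂ (fun w => compression K (R w)) U := by
  let Φ : (H →L[ℂ] H) →L[ℂ] (V →L[ℂ] V) :=
    (ContinuousLinearMap.compL ℂ V H V K) ∘L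
      ((ContinuousLinearMap.compL ℂ V H H).flip V.subtypeL)
  exact (Φ.differentiable.comp_differentiableOn hR).const_sub (1 : V →L[ℂ] V)

/-- Removing a finite rank perturbation from an operator with a bounded resolvent costs a factor
that is exponential in the rank, outside finitely many discs of small total radius. -/
theorem Op.exists_coveredByDiscs_of_perturb {K U : Set ℂ} (hK : IsCompact K) (hKc : Convex ℝ K)
    (hU : IsOpen U) {R₀ : ℝ} (hR₀ : 0 < R₀) (hKU : ∀ c ∈ K, closedBall c (4 * R₀) ⊆ U) {w₁ : ℂ}
    (hw₁ : w₁ ∈ K) {δ : ℝ} (hδ : 0 < δ) {a k a' s : ℝ} (ha : 0 ≤ a) (hk : 0 ≤ k) (ha' : 0 ≤ a')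
    (hs : 0 ≤ s) :
    ∃ C0 C1 : ℝ, 0 < C0 ∧ 0 < C1 ∧ ∀ {H : Type*} [NormedAddCommGroup H] [InnerProductSpace ℂ H]
      (T S : Op H) (V : Submodule ℂ H) [FiniteDimensional ℂ V] (L : H →L[ℂ] V) (r ρ : ℝ), 0 < ρ →
      (∀ x, ‖L x‖ ≤ k * ρ * ‖x‖) →
      (∀ w ∈ U, ∃ R : H →L[ℂ] H,
        (T.perturb (V.subtypeL ∘L L)).IsResolventAt (r + ρ * w) R ∧
        (∀ x, ‖R x‖ ≤ a / ρ * ‖x‖) ∧ ∀ x, ‖S.app (R x)‖ ≤ s * ‖x‖) →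
      (∃ R : H →L[ℂ] H, T.IsResolventAt (r + ρ * w₁) R ∧ ∀ x, ‖R x‖ ≤ a' / ρ * ‖x‖) →
      ∃ B : Set ℂ, CoveredByDiscs B (ρ * δ) ∧ ∀ w ∈ K, (r + ρ * w : ℂ) ∉ B →
        ∃ R : H →L[ℂ] H, T.IsResolventAt (r + ρ * w) R ∧
          (∀ x, ‖R x‖ ≤ C0 * C1 ^ Module.finrank ℂ V / ρ * ‖x‖) ∧
          ∀ x, ‖S.app (R x)‖ ≤ C0 * C1 ^ Module.finrank ℂ V * ‖x‖ := by
  obtain ⟨C, hC1, hC⟩ := exists_coveredByDiscs_norm_lt hK hKc hU hR₀ hKU hw₁ hδ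
  set c := k * a with hc
  set c' := k * a' with hc'
  have hc0 : 0 ≤ c := by positivity
  have hc0' : 0 ≤ c' := by positivity
  set β := Real.log (2 + c + c') with hβ
  have hβ0 : 0 < β := Real.log_pos (by linarith)
  have hexpβ : Real.exp β = 2 + c + c' := Real.exp_log (by linarith)
  refine ⟨(a + s + 1) * ((1 + c) * Real.exp (C * β)), Real.exp (C * β) * (2 * (1 + c) + 1),
    by positivity, by positivity, ?_⟩
  intro H _ _ T S V _ L r ρ hρ hL hRU hR₁
  have hLR : ∀ (R : H →L[ℂ] H) (a : ℝ), (∀ x, ‖R x‖ ≤ a / ρ * ‖x‖) →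
      ∀ x, ‖L (R x)‖ ≤ k * a * ‖x‖ := fun R a hR x => by
    calc ‖L (R x)‖ ≤ k * ρ * ‖R x‖ := hL _
      _ ≤ k * ρ * (a / ρ * ‖x‖) := by gcongr; exact hR x
      _ = k * a * ‖x‖ := by field_simp
  choose! Rt hRt hRtn hRts using hRU
  set m := Module.finrank ℂ V with hm
  set A : ℝ := (m + 1) * β with hA
  have hA0 : 0 < A := by positivity
  have hpow : ∀ t : ℝ, 0 ≤ t → t ≤ 2 + c + c' → t ^ m ≤ Real.exp A := fun t ht0 ht => by
    calc t ^ m ≤ (2 + c + c') ^ m := by gcongr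
      _ = Real.exp (m * β) := by rw [← hexpβ, ← Real.exp_nat_mul]
      _ ≤ Real.exp A := Real.exp_le_exp.2 (by rw [hA]; nlinarith)
  have hcn : ∀ w ∈ U, ∀ v, ‖compression L (Rt w) v‖ ≤ (1 + c) * ‖v‖ := fun w hw v => by
    rw [compression_apply]
    calc _ ≤ ‖v‖ + ‖L (Rt w v)‖ := norm_sub_le _ _
      _ ≤ ‖v‖ + c * ‖v‖ := by gcongr; exact hLR _ a (hRtn w hw) v
      _ = _ := by ring
  have hρ' : (ρ : ℂ) ≠ 0 := by exact_mod_cast hρ.ne'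
  have hdiff : DifferentiableOn ℂ Rt U := by
    have hU' : IsOpen ((fun z : ℂ => (z - r) / ρ) ⁻¹' U) := hU.preimage (by fun_prop)
    have h1 : DifferentiableOn ℂ (fun z : ℂ => Rt ((z - r) / ρ))
        ((fun z : ℂ => (z - r) / ρ) ⁻¹' U) := by
      refine differentiableOn_of_isResolventAt (T := T.perturb (V.subtypeL ∘L L)) (M := a / ρ) hU'
        (fun z hz => ?_) (fun z hz => ?_)
      · have h2 := hRt _ hz
        rwa [mul_div_cancel₀ _ hρ', add_sub_cancel] at h2
      · exact ContinuousLinearMap.opNorm_le_bound _ (by positivity) (hRtn _ hz)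
    have h2 : Set.MapsTo (fun w : ℂ => (r : ℂ) + ρ * w) U ((fun z : ℂ => (z - r) / ρ) ⁻¹' U) := by
      intro w hw
      change ((r : ℂ) + ρ * w - r) / ρ ∈ U
      rwa [add_sub_cancel_left, mul_div_cancel_left₀ _ hρ']
    have h3 := h1.comp (f := fun w : ℂ => (r : ℂ) + ρ * w) (by fun_prop) h2
    refine h3.congr fun w _ => ?_
    change Rt w = Rt (((r : ℂ) + ρ * w - r) / ρ)
    rw [add_sub_cancel_left, mul_div_cancel_left₀ _ hρ']
  have hdiffA : DifferentiableOn ℂ (fun w => compression L (Rt w)) U := by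
    exact differentiableOn_compression L hdiff
  have hcov := hC A (fun w => LinearMap.det (compression L (Rt w) : V →ₗ[ℂ] V)) hA0
    (ContinuousLinearMap.differentiableOn_det hdiffA)
    (fun w hw => (ContinuousLinearMap.norm_det_le _ (hcn w hw)).trans
      (hpow _ (by linarith) (by linarith)))
    (by
      obtain ⟨R', hR', hRn'⟩ := hR₁
      have hw₁U : w₁ ∈ U := hKU w₁ hw₁ (mem_closedBall_self (by positivity))
      have h1 := (hRt w₁ hw₁U).one_le_norm_det_compression hR' (hLR R' a' hRn')
      have h2 := hpow (1 + c') (by linarith) (by linarith)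
      rw [Real.exp_neg, inv_le_iff_one_le_mul₀ (Real.exp_pos _)]
      exact h1.trans (by gcongr))
  refine ⟨_, hcov.image_affine (c := (r : ℂ)) hρ, fun w hw hwB => ?_⟩
  have hwU : w ∈ U := hKU w hw (mem_closedBall_self (by positivity))
  have hdet : Real.exp (-(C * A)) ≤ ‖LinearMap.det (compression L (Rt w) : V →ₗ[ℂ] V)‖ := by
    by_contra! h
    exact hwB ⟨w, ⟨hw, h⟩, rfl⟩
  set ε := Real.exp (-(C * A)) / (2 * (1 + c) + 1) ^ m with hε
  have hε0 : 0 < ε := by positivity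
  obtain ⟨W, hW, hWn⟩ := (hRt w hwU).exists_of_perturb (ε := ε) (c := c) hε0 (fun v => by
    have h1 := (compression L (Rt w)).norm_det_mul_norm_le (by linarith) (hcn w hwU) v
    rw [hε, div_mul_eq_mul_div, div_le_iff₀' (by positivity)]
    exact (mul_le_mul_of_nonneg_right hdet (norm_nonneg _)).trans h1) (hLR _ a (hRtn w hwU))
  set P := (1 + c) * Real.exp (C * β) * (Real.exp (C * β) * (2 * (1 + c) + 1)) ^ m with hP
  have hP0 : 0 ≤ P := by positivity
  have hWP : ∀ x, ‖W x‖ ≤ P * ‖x‖ := by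
    intro x
    refine (hWn x).trans ?_
    gcongr
    have h1 : ε⁻¹ = Real.exp (C * β) * (Real.exp (C * β) * (2 * (1 + c) + 1)) ^ m := by
      have h2 : Real.exp (C * A) = Real.exp (C * β) * Real.exp (C * β) ^ m := by
        rw [← Real.exp_nat_mul, ← Real.exp_add, hA]
        ring_nf
      rw [hε, inv_div, Real.exp_neg, div_inv_eq_mul, mul_pow, h2]
      ring
    have h2 : 1 ≤ ε⁻¹ := by
      rw [h1]
      refine one_le_mul_of_one_le_of_one_le (Real.one_le_exp (by positivity))
        (one_le_pow₀ (one_le_mul_of_one_le_of_one_le (Real.one_le_exp (by positivity)) ?_))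
      linarith
    calc 1 + c / ε = 1 + c * ε⁻¹ := by rw [div_eq_mul_inv]
      _ ≤ ε⁻¹ + c * ε⁻¹ := by gcongr
      _ = P := by rw [h1, hP]; ring
  refine ⟨_, hW, fun x => ?_, fun x => ?_⟩
  · change ‖Rt w (W x)‖ ≤ _
    calc _ ≤ a / ρ * ‖W x‖ := hRtn w hwU _
      _ ≤ a / ρ * (P * ‖x‖) := by gcongr; exact hWP x
      _ ≤ (a + s + 1) / ρ * (P * ‖x‖) := by gcongr; linarith
      _ = _ := by rw [hP]; ring
  · change ‖S.app (Rt w (W x))‖ ≤ _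
    calc _ ≤ s * ‖W x‖ := hRts w hwU _
      _ ≤ s * (P * ‖x‖) := by gcongr; exact hWP x
      _ ≤ (a + s + 1) * (P * ‖x‖) := by gcongr; linarith
      _ = _ := by rw [hP]; ring

theorem HilbertBasis.mem_span_image {ι H : Type*} [NormedAddCommGroup H]
    [InnerProductSpace ℂ H] (e : HilbertBasis ι ℂ H) {J : Set ι} (hJ : J.Finite) {x : H}
    (hx : ∀ i ∉ J, e.repr x i = 0) : x ∈ Submodule.span ℂ (e '' J) := by
  have h1 : HasSum (fun i => e.repr x i • e i) (∑ i ∈ hJ.toFinset, e.repr x i • e i) :=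
    hasSum_sum_of_ne_finset_zero fun i hi => by
      rw [hx i (by simpa using hi), zero_smul]
  rw [(e.hasSum_repr x).unique h1]
  refine Submodule.sum_mem _ fun i hi => Submodule.smul_mem _ _ (Submodule.subset_span ⟨i, ?_, rfl⟩)
  simpa using hi

/-- Spectral subspaces of a diagonal operator are spanned by basis vectors. -/
theorem Op.IsDiagonal.specSubspace_eq_span {H : Type*} [NormedAddCommGroup H]
    [InnerProductSpace ℂ H] {ι : Type*} {G : Op H} {e : HilbertBasis ι ℂ H} {ν : ι → ℂ}
    (hG : G.IsDiagonal e ν) {A : Set ℂ} (hA : {i | ν i ∈ A}.Finite) :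
    G.specSubspace A = Submodule.span ℂ (e '' {i | ν i ∈ A}) := by
  refine le_antisymm (iSup₂_le fun μ hμ => Submodule.span_le.2 ?_) (Submodule.span_le.2 ?_)
  · rintro x ⟨-, k, -, hdom, hk⟩
    refine e.mem_span_image hA fun i hi => ?_
    have hpow : ∀ j ≤ k, e.repr (((G.shift μ) ^ j) x) i = (ν i - μ) ^ j * e.repr x i := by
      intro j
      induction j with
      | zero => simp
      | succ j ih =>
        intro hj
        have h1 : ((G.shift μ) ^ (j + 1)) x =
            G.app (((G.shift μ) ^ j) x) - μ • ((G.shift μ) ^ j) x := by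
          rw [pow_succ', Module.End.mul_apply]
          rfl
        rw [h1, map_sub, map_smul, lp.coeFn_sub, lp.coeFn_smul, Pi.sub_apply, Pi.smul_apply,
          hG.repr_app _ (hdom j (by omega)), ih (by omega), smul_eq_mul]
        ring
    have h2 := hpow k le_rfl
    rw [hk, map_zero, lp.coeFn_zero, Pi.zero_apply, eq_comm, mul_eq_zero] at h2
    rcases h2 with h2 | h2
    · have h3 : ν i = μ := sub_eq_zero.1 (eq_zero_of_pow_eq_zero h2)
      exact absurd (show ν i ∈ A from h3 ▸ hμ) hi
    · exact h2
  · rintro _ ⟨i, hi, rfl⟩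
    refine Submodule.mem_iSup_of_mem (ν i) (Submodule.mem_iSup_of_mem hi
      (Submodule.subset_span ⟨e.orthonormal.ne_zero i, 1, one_pos, fun j hj => ?_, ?_⟩))
    · obtain rfl : j = 0 := by omega
      exact hG.basis_mem i
    · rw [pow_one]
      change G.app (e i) - ν i • e i = 0
      rw [hG.app_basis, sub_self]

theorem mem_omegaSector_of_abs_arg_lt {z : ℂ} {φ : ℝ} (hz : |z.arg| < φ) :
    z ∈ OmegaSector (-φ) φ := by
  rw [abs_lt] at hz
  exact ⟨‖z‖, z.arg, norm_nonneg _, hz.1, hz.2, (Complex.norm_mul_exp_arg_mul_I z).symm⟩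

/-- Points outside of a sector of twice the angle are far away. -/
theorem sin_mul_norm_le_of_mem_closure {φ : ℝ} (hφ0 : 0 < φ) (hφ : φ ≤ Real.pi / 2) {z w : ℂ}
    (hz : z ∈ closure (OmegaSector (-φ) φ)) (hw : w ∉ OmegaSector (-(2 * φ)) (2 * φ)) :
    Real.sin φ * ‖z‖ ≤ ‖w - z‖ := by
  have hclosed : IsClosed {z : ℂ | Real.sin φ * ‖z‖ ≤ ‖w - z‖} :=
    isClosed_le (by fun_prop) (by fun_prop)
  refine closure_minimal ?_ hclosed hz
  rintro _ ⟨t, ψ, ht, hψ1, hψ2, rfl⟩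
  change Real.sin φ * ‖(t : ℂ) * Complex.exp (ψ * Complex.I)‖ ≤ _
  have hnorm : ‖(t : ℂ) * Complex.exp (ψ * Complex.I)‖ = t := by
    rw [norm_mul, Complex.norm_exp_ofReal_mul_I, mul_one, Complex.norm_of_nonneg ht]
  have hsin : 0 ≤ Real.sin φ := Real.sin_nonneg_of_nonneg_of_le_pi hφ0.le (by linarith)
  have harg : 2 * φ ≤ |w.arg| := by
    by_contra! h
    exact hw (mem_omegaSector_of_abs_arg_lt h)
  set θ := w.arg with hθ
  have hθ1 : -Real.pi < θ := Complex.neg_pi_lt_arg w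
  have hθ2 : θ ≤ Real.pi := Complex.arg_le_pi w
  have hcos : Real.cos (θ - ψ) ≤ Real.cos φ := by
    rcases le_abs.1 harg with h | h
    · rcases le_total (θ - ψ) Real.pi with h1 | h1
      · exact Real.cos_le_cos_of_nonneg_of_le_pi hφ0.le h1 (by linarith)
      · rw [← Real.cos_two_pi_sub]
        exact Real.cos_le_cos_of_nonneg_of_le_pi hφ0.le (by linarith) (by linarith)
    · rw [← Real.cos_neg]
      rcases le_total (-(θ - ψ)) Real.pi with h1 | h1
      · exact Real.cos_le_cos_of_nonneg_of_le_pi hφ0.le h1 (by linarith)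
      · rw [← Real.cos_two_pi_sub]
        exact Real.cos_le_cos_of_nonneg_of_le_pi hφ0.le (by linarith) (by linarith)
  have hsq : ‖w - t * Complex.exp (ψ * Complex.I)‖ ^ 2 =
      ‖w‖ ^ 2 - 2 * (‖w‖ * t * Real.cos (θ - ψ)) + t ^ 2 := by
    have h1 : w = ‖w‖ * Complex.exp (θ * Complex.I) := (Complex.norm_mul_exp_arg_mul_I w).symm
    have hre : w.re = ‖w‖ * Real.cos θ := (Complex.norm_mul_cos_arg w).symm
    have him : w.im = ‖w‖ * Real.sin θ := (Complex.norm_mul_sin_arg w).symm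
    rw [← Complex.normSq_eq_norm_sq, Complex.normSq_apply, Complex.sub_re, Complex.sub_im,
      Complex.re_ofReal_mul, Complex.im_ofReal_mul, Complex.exp_ofReal_mul_I_re,
      Complex.exp_ofReal_mul_I_im, hre, him, Real.cos_sub]
    linear_combination ‖w‖ ^ 2 * Real.cos_sq_add_sin_sq θ + t ^ 2 * Real.cos_sq_add_sin_sq ψ
  have h2 : (Real.sin φ * t) ^ 2 ≤ ‖w - t * Complex.exp (ψ * Complex.I)‖ ^ 2 := by
    rw [hsq]
    have h3 : ‖w‖ * t * Real.cos (θ - ψ) ≤ ‖w‖ * t * Real.cos φ := by gcongr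
    nlinarith [Real.sin_sq_add_cos_sq φ, sq_nonneg (‖w‖ - t * Real.cos φ)]
  rw [hnorm]
  exact (sq_le_sq₀ (by positivity) (norm_nonneg _)).1 h2

theorem mem_omegaSector_of_abs_im_lt {φ : ℝ} (hφ0 : 0 < φ) (hφ : φ ≤ Real.pi / 2) {z : ℂ}
    (hz : |z.im| < Real.sin φ * z.re) : z ∈ OmegaSector (-φ) φ := by
  have hsin : 0 < Real.sin φ := Real.sin_pos_of_pos_of_lt_pi hφ0 (by linarith [Real.pi_pos])
  have hre : 0 < z.re := pos_of_mul_pos_right ((abs_nonneg _).trans_lt hz) hsin.le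
  have hz0 : 0 < ‖z‖ := hre.trans_le (Complex.re_le_norm z)
  refine mem_omegaSector_of_abs_arg_lt ?_
  have h1 : |z.im| < Real.sin φ * ‖z‖ := hz.trans_le (by gcongr; exact Complex.re_le_norm z)
  obtain ⟨h2, h3⟩ := abs_lt.1 h1
  rw [Complex.arg_of_re_nonneg hre.le, abs_lt]
  constructor
  · rw [Real.lt_arcsin_iff_sin_lt' ⟨by linarith, by linarith⟩, Real.sin_neg, lt_div_iff₀ hz0]
    linarith
  · rw [Real.arcsin_lt_iff_lt_sin' ⟨by linarith, by linarith⟩, div_lt_iff₀ hz0]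
    exact h3

theorem eventually_mul_rpow_le {p : ℝ} (hp : p < 1) (k : ℝ) {ε : ℝ} (hε : 0 < ε) :
    ∀ᶠ r : ℝ in atTop, k * r ^ p ≤ ε * r := by
  have h1 : Tendsto (fun r : ℝ => k * r ^ (-(1 - p))) atTop (nhds (k * 0)) :=
    (tendsto_rpow_neg_atTop (by linarith)).const_mul k
  rw [mul_zero] at h1
  filter_upwards [h1.eventually_le_const hε, eventually_gt_atTop 0] with r hr hr0
  have h2 : r ^ p = r ^ (-(1 - p)) * r := by
    rw [← Real.rpow_add_one hr0.ne']
    congr 1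
    ring
  rw [h2, ← mul_assoc]
  gcongr

theorem exists_mul_add_rpow_le {p b c s : ℝ} (hp0 : 0 ≤ p) (hp1 : p < 1) (hb : 0 ≤ b)
    (hc : 0 ≤ c) (hs : 0 < s) :
    ∃ α : ℝ, 1 ≤ α ∧ ∀ r : ℝ, 1 ≤ r → ∀ t : ℝ, α * r ^ p ≤ t → b * (2 * t + c * r) ^ p ≤ s * t := by
  obtain ⟨α, ⟨h1, h2⟩, h3⟩ := (((eventually_ge_atTop (2 * b * c ^ p / s)).and
    ((eventually_ge_atTop 1))).and (eventually_atTop.2 ((eventually_atTop.1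
      (eventually_mul_rpow_le hp1 (b * 2 ^ p) (half_pos hs))).imp
        fun A hA B hB t (ht : B ≤ t) => hA t (hB.trans ht)))).exists
  refine ⟨α, h2, fun r hr t ht => ?_⟩
  have hρ : 1 ≤ r ^ p := Real.one_le_rpow hr hp0
  have ht0 : α ≤ t := by nlinarith
  have h4 : (2 * t + c * r) ^ p ≤ 2 ^ p * t ^ p + c ^ p * r ^ p := by
    rw [← Real.mul_rpow (by norm_num) (by linarith), ← Real.mul_rpow hc (by linarith)]
    exact Real.rpow_add_le_add_rpow (by linarith) (by positivity) hp0 hp1.le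
  have h5 := h3 t ht0
  have h6 : b * c ^ p * r ^ p ≤ s / 2 * t := by
    rw [div_le_iff₀ hs] at h1
    have h7 : 0 ≤ c ^ p := by positivity
    have h8 : 2 * b * c ^ p * r ^ p ≤ α * s * r ^ p := by gcongr
    nlinarith
  calc b * (2 * t + c * r) ^ p ≤ b * (2 ^ p * t ^ p + c ^ p * r ^ p) := by gcongr
    _ = b * 2 ^ p * t ^ p + b * c ^ p * r ^ p := by ring
    _ ≤ s / 2 * t + s / 2 * t := add_le_add h5 h6
    _ = s * t := by ring

namespace Op

variable {H : Type*} [NormedAddCommGroup H] [InnerProductSpace ℂ H]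

theorem perturb_zero (T : Op H) : T.perturb 0 = T := by
  simp [perturb]

/-- The resolvent away from the real axis. -/
theorem IsDiagonal.exists_isResolventAt_of_im [CompleteSpace H] {ι : Type*} {G S : Op H}
    {e : HilbertBasis ι ℂ H} {ν : ι → ℂ} (hG : G.IsDiagonal e ν) {p b : ℝ} (hp0 : 0 ≤ p)
    (hp1 : p ≤ 1) (hb : 0 ≤ b) (hS : S.Subordinate G p b) {φ : ℝ} (hφ0 : 0 < φ)
    (hφ : φ ≤ Real.pi / 2)
    (hν : ∀ i, ν i ∈ OmegaSector (-(2 * φ)) (2 * φ) → (ν i).im = 0 ∧ 0 ≤ (ν i).re)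
    {z : ℂ} (hz : z ∈ closure (OmegaSector (-φ) φ)) (hz0 : 0 < |z.im|)
    (hbz : b * (Real.sin φ * |z.im| + ‖z‖) ^ p ≤ Real.sin φ / 2 * |z.im|) :
    ∃ R : H →L[ℂ] H, (G.addOp S).IsResolventAt z R ∧
      (∀ x, ‖R x‖ ≤ 2 / (Real.sin φ * |z.im|) * ‖x‖) ∧ ∀ x, ‖S.app (R x)‖ ≤ ‖x‖ := by
  have hsin : 0 < Real.sin φ := Real.sin_pos_of_pos_of_lt_pi hφ0 (by linarith [Real.pi_pos])
  have hdist : ∀ i, Real.sin φ * |z.im| ≤ ‖ν i + 0 - z‖ := fun i => by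
    rw [add_zero]
    by_cases hi : ν i ∈ OmegaSector (-(2 * φ)) (2 * φ)
    · have h1 := Complex.abs_im_le_norm (ν i - z)
      rw [Complex.sub_im, (hν i hi).1, zero_sub, abs_neg] at h1
      exact (mul_le_of_le_one_left hz0.le (Real.sin_le_one φ)).trans h1
    · refine le_trans ?_ (sin_mul_norm_le_of_mem_closure hφ0 hφ hz hi)
      gcongr
      exact Complex.abs_im_le_norm z
  obtain ⟨R, hR, hRn, hRs⟩ := hG.exists_isResolventAt (K := 0) (κ := fun _ => 0) (z := z)
    (q := 1 / 2) hp0 hp1 hb hS (by simp) (by positivity) hdist (by simp) (by norm_num)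
    (hbz.trans_eq (by ring))
  rw [perturb_zero] at hR
  refine ⟨R, hR, fun x => (hRn x).trans_eq ?_, fun x => (hRs x).trans_eq ?_⟩
  · field_simp
    norm_num
  · norm_num

/-- Moving the eigenvalues in an interval to its right end point gives a finite rank perturbation
with a bounded resolvent. -/
theorem IsDiagonal.exists_perturb [CompleteSpace H] {ι : Type*} {G S : Op H}
    {e : HilbertBasis ι ℂ H} {ν : ι → ℂ} (hG : G.IsDiagonal e ν)
    (hfin : ∀ C : ℝ, {i | ‖ν i‖ ≤ C}.Finite) {p b : ℝ} (hp0 : 0 ≤ p)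
    (hp1 : p ≤ 1) (hb : 0 ≤ b) (hS : S.Subordinate G p b) {φ : ℝ} (hφ0 : 0 < φ)
    (hφ : φ ≤ Real.pi / 2)
    (hν : ∀ i, ν i ∈ OmegaSector (-(2 * φ)) (2 * φ) → (ν i).im = 0 ∧ 0 ≤ (ν i).re)
    {r a : ℝ} (hr : 0 ≤ r) (ha : 0 ≤ a) :
    ∃ V : Submodule ℂ H, V = G.specSubspace {z | z.im = 0 ∧ r - a < z.re ∧ z.re < r + a} ∧
      FiniteDimensional ℂ V ∧ ∃ L : H →L[ℂ] V, (∀ x, ‖L x‖ ≤ 2 * a * ‖x‖) ∧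
      ∀ (z : ℂ) (d q : ℝ), z ∈ closure (OmegaSector (-φ) φ) → 0 < d → |z.re - r| ≤ a - d →
        d ≤ Real.sin φ * ‖z‖ → q < 1 → b * (d + ‖z‖) ^ p ≤ q * d →
        ∃ R : H →L[ℂ] H, ((G.addOp S).perturb (V.subtypeL ∘L L)).IsResolventAt z R ∧
          (∀ x, ‖R x‖ ≤ 1 / (d * (1 - q)) * ‖x‖) ∧ ∀ x, ‖S.app (R x)‖ ≤ q / (1 - q) * ‖x‖ := by
  classical
  set A : Set ℂ := {z | z.im = 0 ∧ r - a < z.re ∧ z.re < r + a} with hA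
  have hreal : ∀ i, ν i ∈ A → ν i = ((ν i).re : ℝ) := fun i hi =>
    Complex.ext rfl hi.1
  have hnorm : ∀ i, ν i ∈ A → ‖ν i‖ ≤ r + a := fun i hi => by
    rw [hreal i hi, Complex.norm_real, Real.norm_eq_abs, abs_le]
    constructor <;> linarith [hi.2.1, hi.2.2]
  have hJ : {i | ν i ∈ A}.Finite := (hfin (r + a)).subset hnorm
  set κ : ι → ℂ := fun i => if ν i ∈ A then ((r + a : ℝ) : ℂ) - ν i else 0 with hκ
  have hκin : ∀ i, ν i ∈ A → κ i = ((r + a : ℝ) : ℂ) - ν i := fun i hi => by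
    rw [hκ]
    exact if_pos hi
  have hκout : ∀ i, ν i ∉ A → κ i = 0 := fun i hi => by
    rw [hκ]
    exact if_neg hi
  have hκn : ∀ i, ‖κ i‖ ≤ 2 * a := fun i => by
    by_cases hi : ν i ∈ A
    · rw [hκin i hi, hreal i hi, ← Complex.ofReal_sub, Complex.norm_real, Real.norm_eq_abs, abs_le]
      constructor <;> linarith [hi.2.1, hi.2.2]
    · rw [hκout i hi, norm_zero]
      positivity
  obtain ⟨K, hK, hKn⟩ := e.exists_diagonal (by positivity) hκn
  have hspan := hG.specSubspace_eq_span hJ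
  have hKV : ∀ x, K x ∈ G.specSubspace A := fun x => by
    rw [hspan]
    refine e.mem_span_image hJ fun i hi => ?_
    rw [hK, hκout i hi, zero_mul]
  refine ⟨_, rfl, ?_, K.codRestrict _ hKV, hKn, fun z d q hz hd hzr hdz hq hbz => ?_⟩
  · rw [hspan]
    exact FiniteDimensional.span_of_finite ℂ (hJ.image _)
  have hdist : ∀ i, d ≤ ‖ν i + κ i - z‖ := fun i => by
    obtain ⟨hz1, hz2⟩ := abs_le.1 hzr
    by_cases hi : ν i ∈ A
    · rw [hκin i hi, add_sub_cancel]
      have h1 := Complex.re_le_norm (((r + a : ℝ) : ℂ) - z)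
      rw [Complex.sub_re, Complex.ofReal_re] at h1
      linarith
    · rw [hκout i hi, add_zero]
      by_cases hi' : ν i ∈ OmegaSector (-(2 * φ)) (2 * φ)
      · have h1 := Complex.abs_re_le_norm (ν i - z)
        rw [Complex.sub_re] at h1
        refine le_trans ?_ h1
        by_contra! h2
        obtain ⟨h3, h4⟩ := abs_lt.1 h2
        exact hi ⟨(hν i hi').1, by linarith, by linarith⟩
      · exact hdz.trans (sin_mul_norm_le_of_mem_closure hφ0 hφ hz hi')
  have hle : ∀ i, ‖ν i‖ ≤ ‖ν i + κ i‖ := fun i => by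
    by_cases hi : ν i ∈ A
    · rw [hκin i hi, add_sub_cancel, Complex.norm_real, Real.norm_of_nonneg (by positivity)]
      exact hnorm i hi
    · rw [hκout i hi, add_zero]
  exact hG.exists_isResolventAt hp0 hp1 hb hS hK hd hdist hle hq hbz

end Op

theorem eventually_mul_add_rpow_le {p b c M : ℝ} (hp1 : p < 1) (hb : 0 ≤ b)
    (hc : 0 ≤ c) (hM : b < M) :
    ∀ᶠ r : ℝ in atTop, b * (r + c * r ^ p) ^ p ≤ M * r ^ p := by
  filter_upwards [eventually_mul_rpow_le hp1 (b * c) (sub_pos.2 hM), eventually_ge_atTop 1]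
    with r hr hr1
  have hr0 : 0 < r := by linarith
  have hρ : 0 < r ^ p := by positivity
  have h1 : (r + c * r ^ p) ^ p ≤ r ^ p * (1 + c * r ^ p / r) := by
    have h2 : r + c * r ^ p = r * (1 + c * r ^ p / r) := by field_simp
    have h3 : 1 ≤ 1 + c * r ^ p / r := by
      have : 0 ≤ c * r ^ p / r := by positivity
      linarith
    rw [h2, Real.mul_rpow hr0.le (by linarith)]
    gcongr
    exact (Real.rpow_le_rpow_of_exponent_le h3 hp1.le).trans_eq (Real.rpow_one _)
  have h4 : b * (1 + c * r ^ p / r) ≤ M := by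
    have h5 : b * c * r ^ p / r ≤ M - b := by rwa [div_le_iff₀ hr0]
    calc b * (1 + c * r ^ p / r) = b + b * c * r ^ p / r := by ring
      _ ≤ M := by linarith
  calc b * (r + c * r ^ p) ^ p ≤ b * (r ^ p * (1 + c * r ^ p / r)) := by gcongr
    _ = b * (1 + c * r ^ p / r) * r ^ p := by ring
    _ ≤ M * r ^ p := by gcongr

theorem Op.mem_resolventSet_of_isResolventAt {H : Type*} [NormedAddCommGroup H]
    [InnerProductSpace ℂ H] {T S : Op H} {z : ℂ} {R₀ : H →L[ℂ] H} {a c : ℝ} (ha : 0 ≤ a)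
    (h : T.IsResolventAt z R₀) (h₁ : ∀ x, ‖R₀ x‖ ≤ a * ‖x‖) (h₂ : ∀ x, ‖S.app (R₀ x)‖ ≤ c * ‖x‖) :
    z ∈ T.resolventSet ∧ ∀ R : H →L[ℂ] H, T.IsResolventAt z R →
      ‖R‖ ≤ a ∧ ∀ x, ‖S.app (R x)‖ ≤ c * ‖x‖ := by
  refine ⟨⟨R₀, h⟩, fun R hR => ?_⟩
  rw [hR.unique h]
  exact ⟨R₀.opNorm_le_bound ha h₁, h₂⟩

/-- resolvent estimates outside finitely many exceptional discs, with bound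
`C₀ C₁^m / r^p` where `m = N₊(r - l rᵖ, r + l rᵖ, G)`. -/
theorem statement11 {H : Type*} [NormedAddCommGroup H] [InnerProductSpace ℂ H]
    [CompleteSpace H] (G S T : Op H)
    (hG : G.IsNormalOp) (hGres : G.HasCompactResolvent)
    (φ : ℝ) (hφ0 : 0 < φ) (hφ : φ ≤ Real.pi / 2)
    (hspec : G.spec ∩ OmegaSector (-(2 * φ)) (2 * φ) ⊆ {z : ℂ | z.im = 0 ∧ 0 ≤ z.re})
    (p b : ℝ) (hp0 : 0 ≤ p) (hp1 : p < 1) (hb : 0 ≤ b)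
    (hsub : S.Subordinate G p b)
    (hT : T = G.addOp S)
    (l l0 η : ℝ) (hl : b < l) (hl0 : 0 ≤ l0) (hl0' : l0 < l - b) (hη : 0 < η) :
    ∃ C0 C1 r0 : ℝ, 0 < C0 ∧ 0 < C1 ∧ 0 < r0 ∧
      ∀ r : ℝ, r0 ≤ r →
        ∃ E : Finset (ℂ × ℝ),
          (∀ d ∈ E, 0 ≤ d.2) ∧ (∑ d ∈ E, d.2 ≤ η * r ^ p) ∧
          ∀ z ∈ closure (OmegaSector (-φ) φ) \ ⋃ d ∈ E, Metric.closedBall d.1 d.2,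
            |z.re - r| ≤ l0 * r ^ p →
            z ∈ T.resolventSet ∧
              ∀ R : H →L[ℂ] H, T.IsResolventAt z R →
                ‖R‖ ≤ C0 * C1 ^ (G.dimPlus (r - l * r ^ p) (r + l * r ^ p)) / r ^ p ∧
                ∀ x : H, ‖S.app (R x)‖ ≤
                  C0 * C1 ^ (G.dimPlus (r - l * r ^ p) (r + l * r ^ p)) * ‖x‖ := by
  subst hT
  obtain ⟨ι, e, ν, he, hrepr, hdom, hfin⟩ := hG.exists_hilbertBasis hGres
  have hD : G.IsDiagonal e ν := ⟨fun i => (he i).1, fun i => (he i).2, hrepr, hdom⟩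
  have hν : ∀ i, ν i ∈ OmegaSector (-(2 * φ)) (2 * φ) → (ν i).im = 0 ∧ 0 ≤ (ν i).re :=
    fun i hi => hspec ⟨Op.mem_spec_of_app_eq_smul (he i).1 (e.orthonormal.ne_zero i) (he i).2, hi⟩
  set s := Real.sin φ with hs_def
  have hs : 0 < s := Real.sin_pos_of_pos_of_lt_pi hφ0 (by linarith [Real.pi_pos])
  have hs1 : s ≤ 1 := Real.sin_le_one φ
  obtain ⟨l₁, hl₁, hl₁'⟩ := exists_between hl0'
  have hd₀ : 0 < l - l₁ := by linarith
  have hl₁0 : 0 < l₁ := by linarith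
  obtain ⟨q, hq, hq1⟩ := exists_between ((div_lt_one hd₀).2 (by linarith : b < l - l₁))
  have hq0 : 0 ≤ q := (by positivity : 0 ≤ b / (l - l₁)).trans hq.le
  rw [div_lt_iff₀ hd₀] at hq
  obtain ⟨α, hα1, hα⟩ := exists_mul_add_rpow_le hp0 hp1 hb (by linarith : 0 ≤ 1 + l₁) (half_pos hs)
  have hα0 : 0 < α := by linarith
  obtain ⟨C0, C1, hC0, hC1, hC⟩ := Op.exists_coveredByDiscs_of_perturb
    (K := Set.Icc (-l0) l0 ×ℂ Set.Icc (-α) α) (U := Set.Ioo (-l₁) l₁ ×ℂ Set.Ioo (-(α + 1)) (α + 1))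
    (R₀ := min (l₁ - l0) 1 / 8) (w₁ := α * I) (δ := η) (a := 1 / ((l - l₁) * (1 - q)))
    (k := 2 * l) (a' := 2 / (s * α)) (s := q / (1 - q))
    (isCompact_Icc.reProdIm isCompact_Icc)
    (((convex_Icc _ _).linear_preimage Complex.reLm).inter
      ((convex_Icc _ _).linear_preimage Complex.imLm)) (isOpen_Ioo.reProdIm isOpen_Ioo)
    (by have : 0 < min (l₁ - l0) 1 := lt_min (by linarith) one_pos
        positivity)
    (fun c hc w hw => by
      obtain ⟨⟨hc1, hc2⟩, hc3, hc4⟩ := hc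
      rw [mem_closedBall, dist_eq_norm] at hw
      have h0 : 0 < min (l₁ - l0) 1 := lt_min (by linarith) one_pos
      have h1 := abs_le.1 ((Complex.abs_re_le_norm (w - c)).trans hw)
      have h2 := abs_le.1 ((Complex.abs_im_le_norm (w - c)).trans hw)
      have h3 := min_le_left (l₁ - l0) 1
      have h4 := min_le_right (l₁ - l0) 1
      rw [Complex.sub_re] at h1
      rw [Complex.sub_im] at h2
      exact ⟨⟨by linarith, by linarith⟩, by linarith, by linarith⟩)
    (by simp [Complex.mem_reProdIm, hl0, hα0.le]) hη
    (by have := sub_pos.2 hq1; positivity) (by linarith) (by positivity)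
    (div_nonneg hq0 (sub_pos.2 hq1).le)
  obtain ⟨r₀, hr₀⟩ := eventually_atTop.1 <|
    (eventually_mul_rpow_le hp1 (α + 1 + s * l₁) (half_pos hs)).and <|
    (eventually_mul_rpow_le hp1 (l - l₁ + s * l₁) hs).and <|
    eventually_mul_add_rpow_le hp1 hb (by linarith : 0 ≤ l + α + 1) hq
  refine ⟨C0 + 2 / (s * α) + 1, C1 + 1, max r₀ 1, by positivity, by positivity, by positivity,
    fun r hr => ?_⟩
  obtain ⟨h1, h2, h3⟩ := hr₀ r ((le_max_left _ _).trans hr)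
  have hr1 : 1 ≤ r := (le_max_right _ _).trans hr
  clear hr hr₀
  have hρr : r ^ p ≤ r := (Real.rpow_le_rpow_of_exponent_le hr1 hp1.le).trans_eq (Real.rpow_one r)
  have hρ : 0 < r ^ p := by positivity
  have hαρ := hα r hr1
  set ρ := r ^ p with hρ_def
  have hr0 : 0 < r := by linarith
  have hfar : ∀ z ∈ closure (OmegaSector (-φ) φ), |z.re - r| ≤ l₁ * ρ → α * ρ ≤ |z.im| →
      ∃ R : H →L[ℂ] H, (G.addOp S).IsResolventAt z R ∧
        (∀ x, ‖R x‖ ≤ 2 / (s * α) / ρ * ‖x‖) ∧ ∀ x, ‖S.app (R x)‖ ≤ ‖x‖ := by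
    intro z hz hzr hzi
    have hzi0 : 0 < |z.im| := lt_of_lt_of_le (by positivity) hzi
    obtain ⟨R, hR, hRn, hRs⟩ := hD.exists_isResolventAt_of_im hp0 hp1.le hb hsub hφ0 hφ hν hz hzi0
      (by
        refine le_trans ?_ (hαρ _ hzi)
        have h4 := Complex.norm_le_abs_re_add_abs_im z
        have h5 : |z.re| ≤ r + l₁ * r := by
          have := abs_sub_abs_le_abs_sub z.re r
          rw [abs_of_pos hr0] at this
          nlinarith
        have h6 : s * |z.im| ≤ |z.im| := mul_le_of_le_one_left hzi0.le hs1
        exact mul_le_mul_of_nonneg_left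
          (Real.rpow_le_rpow (by positivity) (by linarith) hp0) hb)
    refine ⟨R, hR, fun x => (hRn x).trans ?_, hRs⟩
    rw [div_div, mul_assoc]
    gcongr
  have hnear : ∀ z : ℂ, |z.re - r| ≤ l₁ * ρ → |z.im| ≤ (α + 1) * ρ →
      z ∈ closure (OmegaSector (-φ) φ) := fun z hzr hzi => by
    obtain ⟨h4, h5⟩ := abs_le.1 hzr
    refine subset_closure (mem_omegaSector_of_abs_im_lt hφ0 hφ (hzi.trans_lt ?_))
    nlinarith
  obtain ⟨V, hV, hVfin, L, hL, hpert⟩ := hD.exists_perturb hfin hp0 hp1.le hb hsub hφ0 hφ hν hr0.le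
    (mul_nonneg (by linarith : 0 ≤ l) hρ.le)
  have hdim : Module.finrank ℂ V = G.dimPlus (r - l * ρ) (r + l * ρ) := by rw [hV]; rfl
  rw [← hdim]
  obtain ⟨B, ⟨E, hE0, hEs, hBE⟩, hB⟩ := hC (G.addOp S) S V L r ρ hρ
    (fun x => (hL x).trans_eq (by ring))
    (fun w hw => by
      obtain ⟨⟨hw1, hw2⟩, hw3, hw4⟩ := hw
      have hre : ((r + ρ * w : ℂ)).re - r = ρ * w.re := by simp
      have him : ((r + ρ * w : ℂ)).im = ρ * w.im := by simp
      have hzr : |((r + ρ * w : ℂ)).re - r| ≤ l₁ * ρ := by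
        rw [hre, abs_mul, abs_of_pos hρ, mul_comm]
        gcongr
        exact abs_le.2 ⟨hw1.le, hw2.le⟩
      have hzi : |((r + ρ * w : ℂ)).im| ≤ (α + 1) * ρ := by
        rw [him, abs_mul, abs_of_pos hρ, mul_comm]
        gcongr
        exact abs_le.2 ⟨hw3.le, hw4.le⟩
      generalize (r + ρ * w : ℂ) = z at hzr hzi
      clear hre him
      have h4 : (l - l₁) * ρ ≤ s * ‖z‖ := by
        have h5 := Complex.re_le_norm z
        have h6 := (abs_le.1 hzr).1
        have h7 : s * (r - l₁ * ρ) ≤ s * ‖z‖ := by gcongr; linarith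
        linarith
      have h5 : b * ((l - l₁) * ρ + ‖z‖) ^ p ≤ q * ((l - l₁) * ρ) := by
        refine le_trans ?_ (h3.trans_eq (by ring))
        have h6 := Complex.norm_le_abs_re_add_abs_im z
        have h7 := abs_sub_abs_le_abs_sub z.re r
        rw [abs_of_pos hr0] at h7
        exact mul_le_mul_of_nonneg_left
          (Real.rpow_le_rpow (by positivity) (by linarith) hp0) hb
      obtain ⟨R, hR, hRn, hRs⟩ := hpert z ((l - l₁) * ρ) q (hnear z hzr hzi) (by positivity)
        (hzr.trans_eq (by ring)) h4 hq1 h5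
      refine ⟨R, hR, fun x => (hRn x).trans_eq ?_, hRs⟩
      have := (sub_pos.2 hq1).ne'
      field_simp)
    (by
      obtain ⟨R, hR, hRn, -⟩ := hfar (r + ρ * (α * I)) (hnear _ (by simp; positivity)
        (by simp [abs_of_pos, hρ, hα0]; linarith)) (by simp; positivity)
        (by simp [abs_of_pos, hρ, hα0]; linarith)
      exact ⟨R, hR, hRn⟩)
  set m := Module.finrank ℂ V
  have hC1m : 1 ≤ (C1 + 1) ^ m := one_le_pow₀ (by linarith)
  have hCm : C0 * C1 ^ m ≤ (C0 + 2 / (s * α) + 1) * (C1 + 1) ^ m := by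
    have : 0 < 2 / (s * α) := by positivity
    gcongr <;> linarith
  have hA : 0 ≤ 2 / (s * α) := by positivity
  refine ⟨E, hE0, hEs.trans_eq (mul_comm _ _), fun z ⟨hz, hzE⟩ hzr => ?_⟩
  by_cases hzi : α * ρ ≤ |z.im|
  · obtain ⟨R, hR, hRn, hRs⟩ := hfar z hz (hzr.trans (by gcongr)) hzi
    refine Op.mem_resolventSet_of_isResolventAt (by positivity) hR (fun x => (hRn x).trans ?_)
      fun x => (hRs x).trans ?_
    · gcongr
      nlinarith
    · refine le_mul_of_one_le_left (norm_nonneg x) ?_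
      nlinarith
  · have hw : (r + ρ * ((z - r) / ρ) : ℂ) = z := by
      rw [mul_div_cancel₀ _ (by exact_mod_cast hρ.ne'), add_sub_cancel]
    obtain ⟨R, hR, hRn, hRs⟩ := hB ((z - r) / ρ)
      (by
        rw [not_le] at hzi
        rw [Complex.mem_reProdIm, Complex.div_ofReal_re, Complex.div_ofReal_im, Set.mem_Icc,
          Set.mem_Icc, ← abs_le, ← abs_le, abs_div, abs_div, abs_of_pos hρ, div_le_iff₀ hρ,
          div_le_iff₀ hρ]
        simpa using ⟨hzr, hzi.le⟩)
      (by
        rw [hw]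
        exact fun h => hzE (hBE h))
    rw [hw] at hR
    refine Op.mem_resolventSet_of_isResolventAt (by positivity) hR (fun x => (hRn x).trans ?_)
      fun x => (hRs x).trans ?_
    all_goals gcongr
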